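/- Fix n_0 ≥ 1 and a non-constant Boolean function f_0 of n_0 variables, identified for n ≥ n_0 with its extension to n variables. Then Σ_{g ≥ f_0} P_n(g) = P_n(True)·(1 + o(1)) as n → ∞, where the sum ranges over all Boolean functions g of n variables with g ≥ f_0. -/

import Mathlib

/-- An and/or tree skeleton: leaves carry a variable index and a polarity
(`true` = positive literal, `false` = negated literal); internal nodes carry
a connective (`true` = AND, `false` = OR) and a list of children. -/
inductive AT (n : ℕ) : Type
  | leaf : Fin n → Bool → AT n
  | node : Bool → List (AT n) → AT n

namespace AT

/-- The connective at the root, if the root is an internal node. -/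
def rootConn {n : ℕ} : AT n → Option Bool
  | .leaf _ _ => none
  | .node c _ => some c

/-- Whether a tree is a single leaf. -/
def isLeafB {n : ℕ} : AT n → Bool
  | .leaf _ _ => true
  | .node _ _ => false

/-- The children of the root. -/
def rootChildren {n : ℕ} : AT n → List (AT n)
  | .leaf _ _ => []
  | .node _ ts => ts

/-- Well-formedness: an associative tree is a plane tree in which each internal
node has at least two children, no internal node has the same connective as its
parent (stratification), and leaves carry literals. -/
inductive WF {n : ℕ} : AT n → Prop
  | leaf (i : Fin n) (b : Bool) : WF (.leaf i b)
  | node (c : Bool) (ts : List (AT n)) :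
      2 ≤ ts.length → (∀ t ∈ ts, WF t) → (∀ t ∈ ts, rootConn t ≠ some c) →
      WF (.node c ts)

mutual
/-- The size of a tree: its total number of nodes. -/
def size {n : ℕ} : AT n → ℕ
  | .leaf _ _ => 1
  | .node _ ts => 1 + sizeList ts
def sizeList {n : ℕ} : List (AT n) → ℕ
  | [] => 0
  | t :: ts => size t + sizeList ts
end

mutual
/-- The Boolean function computed by a tree. -/
def eval {n : ℕ} : AT n → (Fin n → Bool) → Bool
  | .leaf i b, x => if b then x i else ! x i
  | .node c ts, x => evalList c ts x
def evalList {n : ℕ} : Bool → List (AT n) → (Fin n → Bool) → Bool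
  | c, [], _ => c
  | c, t :: ts, x => if c then eval t x && evalList c ts x
                     else eval t x || evalList c ts x
end

end AT

open AT

/-- Number of associative trees of size `m` in a family `𝒯`. -/
noncomputable def countIn (n : ℕ) (𝒯 : Set (AT n)) (m : ℕ) : ℕ :=
  Nat.card {t : AT n // t ∈ 𝒯 ∧ WF t ∧ size t = m}

/-- `A n m` is the number of associative trees of size `m` on `n` variables. -/
noncomputable def A (n m : ℕ) : ℕ := countIn n Set.univ m

/-- `Pmn n m f` is the proportion, among associative trees of size `m` on `n`
variables, of those computing the Boolean function `f`. -/
noncomputable def Pmn (n m : ℕ) (f : (Fin n → Bool) → Bool) : ℝ :=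
  (countIn n {t | eval t = f} m : ℝ) / (A n m : ℝ)

/-- Ratio of trees of size `m` in the family `𝒯` among all trees of size `m`. -/
noncomputable def ratio (n : ℕ) (𝒯 : Set (AT n)) (m : ℕ) : ℝ :=
  (countIn n 𝒯 m : ℝ) / (A n m : ℝ)

/-- `HasLimRatio n 𝒯 μ` : the limiting ratio of the family `𝒯` exists and is `μ`. -/
def HasLimRatio (n : ℕ) (𝒯 : Set (AT n)) (μ : ℝ) : Prop :=
  Filter.Tendsto (ratio n 𝒯) Filter.atTop (nhds μ)

/-- Extension of a Boolean function of `n₀` variables to `n ≥ n₀` variables. -/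
def extend {n₀ n : ℕ} (h : n₀ ≤ n) (f : (Fin n₀ → Bool) → Bool) :
    (Fin n → Bool) → Bool :=
  fun x => f (fun j => x (Fin.castLE h j))

open Classical in
/-- The tree size complexity of a Boolean function. -/
noncomputable def Lcomp (n : ℕ) (f : (Fin n → Bool) → Bool) : ℕ :=
  if f = (fun _ => true) ∨ f = (fun _ => false) then 0
  else if ∃ i : Fin n, f = (fun x => x i) ∨ f = (fun x => ! x i) then 2
  else sInf {m | ∃ t : AT n, WF t ∧ size t = m ∧ eval t = f}



namespace AndOr

open Filter Topology Finset

/-- Contraction principle along a filter. -/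
lemma contr {α : Type*} {l : Filter α} {x : α → ℝ} {q C₀ : ℝ} (hq0 : 0 ≤ q) (hq : q < 1)
    (hC : ∀ᶠ a in l, x a ≤ C₀) (hC0 : 0 ≤ C₀)
    (step : ∀ C, 0 ≤ C → (∀ᶠ a in l, x a ≤ C) → ∀ η > 0, ∀ᶠ a in l, x a ≤ q * C + η) :
    ∀ η > 0, ∀ᶠ a in l, x a ≤ η := by
  intro η hη
  -- iterate
  have key : ∀ k : ℕ, ∀ᶠ a in l, x a ≤ q ^ k * C₀ + η / 2 := by
    intro k
    induction k with
    | zero => filter_upwards [hC] with a ha; simp; linarith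
    | succ k ih =>
      have := step _ (by positivity) ih ((1 - q) * (η / 2)) (by
        have : 0 < 1 - q := by linarith
        positivity)
      filter_upwards [this] with a ha
      refine ha.trans (le_of_eq ?_)
      rw [pow_succ]; ring
  have h0 : Tendsto (fun k : ℕ => q ^ k * C₀) atTop (𝓝 (0 * C₀)) :=
    (tendsto_pow_atTop_nhds_zero_of_lt_one hq0 hq).mul_const _
  rw [zero_mul] at h0
  obtain ⟨k, hk⟩ := (h0.eventually (gt_mem_nhds (half_pos hη))).exists
  filter_upwards [key k] with a ha
  linarith

lemma contr_seq {x e : ℕ → ℝ} {q : ℝ} (hq0 : 0 ≤ q) (hq : q < 1) (hx : ∀ m, 0 ≤ x m)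
    (m₀ : ℕ)
    (he : Tendsto e atTop (𝓝 0)) (h : ∀ m ≥ m₀, x (m + 1) ≤ q * x m + e m) :
    Tendsto x atTop (𝓝 0) := by
  -- bounded
  obtain ⟨E, hE⟩ := he.bddAbove_range
  have hE' : ∀ m, e m ≤ E := fun m => hE ⟨m, rfl⟩
  have h1q : 0 < 1 - q := by linarith
  set C₀ := max (x m₀) (E / (1 - q)) with hC₀
  have hb : ∀ m ≥ m₀, x m ≤ C₀ := by
    intro m hm
    induction m, hm using Nat.le_induction with
    | base => exact le_max_left _ _
    | succ m hm ih =>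
      have h2 := h m hm
      have h3 : E ≤ (1 - q) * C₀ := by
        have : E / (1 - q) ≤ C₀ := le_max_right _ _
        rw [div_le_iff₀ h1q] at this
        linarith
      have h4 := hE' m
      nlinarith [mul_le_mul_of_nonneg_left ih hq0]
  have hC0 : 0 ≤ C₀ := (hx m₀).trans (le_max_left _ _)
  have := contr (l := atTop) (x := x) hq0 hq (eventually_atTop.2 ⟨m₀, hb⟩) hC0 (by
    intro C hC hev η hη
    have h5 : ∀ᶠ m in atTop, e m < η := he.eventually (gt_mem_nhds hη)
    have h6 : ∀ᶠ m in atTop, x (m + 1) ≤ q * C + η := by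
      filter_upwards [hev, h5, eventually_ge_atTop m₀] with m h7 h8 h9
      have := h m h9
      nlinarith [mul_le_mul_of_nonneg_left h7 hq0]
    exact (eventually_atTop.2 (by
      obtain ⟨M, hM⟩ := eventually_atTop.1 h6
      refine ⟨M + 1, fun m hm => ?_⟩
      obtain ⟨k, rfl⟩ : ∃ k, m = k + 1 := ⟨m - 1, by omega⟩
      exact hM k (by omega))))
  rw [Metric.tendsto_atTop]
  intro η hη
  obtain ⟨M, hM⟩ := eventually_atTop.1 (this (η / 2) (half_pos hη))
  refine ⟨M, fun m hm => ?_⟩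
  rw [Real.dist_eq, sub_zero, abs_of_nonneg (hx m)]
  linarith [hM m hm]

/-- Data: the Motzkin-like sequence. -/
structure Mot (β : ℝ) (l : ℕ → ℝ) : Prop where
  hβ : 2 ≤ β
  nonneg : ∀ m, 0 ≤ l m
  h0 : l 0 = 0
  h1 : l 1 = β
  rec' : ∀ m, l (m + 2) = β * l (m + 1) + ∑ p ∈ antidiagonal (m + 1), l p.1 * l p.2

namespace Mot

variable {β : ℝ} {l : ℕ → ℝ}

open PowerSeries in
lemma threeTerm (h : Mot β l) (m : ℕ) :
    (m + 4 : ℝ) * l (m + 3) = β * (2 * m + 5) * l (m + 2)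
      - (β ^ 2 - 4 * β) * (m + 1) * l (m + 1) := by
  set L : PowerSeries ℝ := PowerSeries.mk l with hL
  have c2 : (C (2 : ℝ) : PowerSeries ℝ) = 2 := map_ofNat C 2
  have c4 : (C (4 : ℝ) : PowerSeries ℝ) = 4 := map_ofNat C 4
  have hquad' : L = X * C β + X * (C β * L) + X * (L * L) := by
    ext k
    rcases k with _ | _ | k
    · simp only [map_add, coeff_zero_X_mul]
      simp [hL, h.h0]
    · simp only [map_add, coeff_succ_X_mul, coeff_C_mul]
      simp only [coeff_mul, hL, coeff_mk]
      simp [h.h1, h.h0]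
    · simp only [map_add, coeff_succ_X_mul, coeff_C_mul]
      simp only [coeff_mul, hL, coeff_mk]
      rw [h.rec']
      simp
  have hquad : L = C β * X + C β * X * L + X * L ^ 2 := by
    linear_combination hquad'
  set S : PowerSeries ℝ := 1 - C β * X - 2 * X * L with hS
  set D : PowerSeries ℝ := 1 - C (2 * β) * X + C (β ^ 2 - 4 * β) * X ^ 2 with hD
  have hSD : S ^ 2 = D := by
    have e1 : (C (2 * β) : PowerSeries ℝ) = 2 * C β := by rw [map_mul, c2]
    have e2 : (C (β ^ 2 - 4 * β) : PowerSeries ℝ) = C β ^ 2 - 4 * C β := by rw [map_sub, map_mul, c4, map_pow]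
    rw [hS, hD, e1, e2]
    linear_combination (-4 * X) * hquad
  have hSne : S ≠ 0 := by
    intro h0
    have := congrArg (constantCoeff (R := ℝ)) h0
    simp [hS] at this
  have hode : 2 * D * derivative ℝ S = derivative ℝ D * S := by
    apply mul_left_cancel₀ hSne
    have := congrArg (derivative ℝ) hSD
    rw [sq, Derivation.leibniz] at this
    simp only [smul_eq_mul] at this
    rw [← this, ← hSD]
    ring
  have hs : ∀ k, coeff (k + 2) S = - 2 * l (k + 1) := by
    intro k
    have : S = 1 - X * C β - X * (C 2 * L) := by
      rw [hS, c2]; ring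
    rw [this]
    simp only [map_sub, coeff_succ_X_mul, coeff_C_mul, hL, coeff_mk, coeff_one, coeff_C]
    simp
  have hD' : derivative ℝ D = - C (2 * β) + X * C (2 * (β ^ 2 - 4 * β)) := by
    have gen : ∀ u v : ℝ, derivative ℝ (1 - C u * X + C v * (X * X) : PowerSeries ℝ)
        = - C u + X * (2 * C v) := by
      intro u v
      simp [Derivation.leibniz]
      ring
    rw [hD, sq X, gen]
    rw [map_mul C 2 (β ^ 2 - 4 * β), c2]
  rw [hD', hD] at hode
  have hc := congrArg (coeff (m + 3)) hode
  have lhs : 2 * (1 - C (2 * β) * X + C (β ^ 2 - 4 * β) * X ^ 2) * derivative ℝ S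
      = C 2 * derivative ℝ S - C (4 * β) * (X * derivative ℝ S)
        + C (2 * (β ^ 2 - 4 * β)) * (X * (X * derivative ℝ S)) := by
    simp [c2, c4]; ring
  have rhs : (- C (2 * β) + X * C (2 * (β ^ 2 - 4 * β))) * S
      = - (C (2 * β) * S) + X * (C (2 * (β ^ 2 - 4 * β)) * S) := by ring
  rw [lhs, rhs] at hc
  simp only [map_add, map_sub, map_neg, coeff_C_mul, coeff_succ_X_mul, coeff_derivative, hs] at hc
  push_cast at hc
  linear_combination (-1/4) * hc

end Mot
end AndOr


namespace AndOr

open Filter Topology Finset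

/-- inverse radius -/
noncomputable def RR (β : ℝ) : ℝ := β + 2 * √β

/-- radius -/
noncomputable def rho (β : ℝ) : ℝ := (RR β)⁻¹

lemma RR_pos {β : ℝ} (h : 2 ≤ β) : 0 < RR β := by
  unfold RR; positivity

lemma rho_pos {β : ℝ} (h : 2 ≤ β) : 0 < rho β := inv_pos.2 (RR_pos h)

namespace Mot

variable {β : ℝ} {l : ℕ → ℝ}

lemma ge_mul (h : Mot β l) (m : ℕ) : β * l (m + 1) ≤ l (m + 2) := by
  rw [h.rec']
  have : 0 ≤ ∑ p ∈ antidiagonal (m + 1), l p.1 * l p.2 :=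
    sum_nonneg fun p _ => mul_nonneg (h.nonneg _) (h.nonneg _)
  linarith

lemma pos (h : Mot β l) (m : ℕ) : 0 < l (m + 1) := by
  have hβ := h.hβ
  induction m with
  | zero => rw [zero_add, h.h1]; linarith
  | succ m ih =>
    have := h.ge_mul m
    have : 0 < β * l (m + 1) := by positivity
    linarith

lemma pos' (h : Mot β l) {m : ℕ} (hm : 1 ≤ m) : 0 < l m := by
  obtain ⟨k, rfl⟩ : ∃ k, m = k + 1 := ⟨m - 1, by omega⟩
  exact h.pos k

lemma ratio_aux (h : Mot β l) :
    Tendsto (fun m => l (m + 2) / l (m + 1)) atTop (𝓝 (RR β)) := by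
  have hβ := h.hβ
  have hR := RR_pos hβ
  set R := RR β with hRdef
  set w := √β with hw
  have hw2 : w ^ 2 = β := Real.sq_sqrt (by linarith)
  have hw1 : 1 < w := by
    rw [hw]; apply Real.lt_sqrt_of_sq_lt; linarith
  have hRw : R = w ^ 2 + 2 * w := by rw [hRdef, RR, hw2]
  set t : ℕ → ℝ := fun m => l (m + 2) / l (m + 1) with ht
  have htβ : ∀ m, β ≤ t m := fun m => by
    rw [ht]; simp only
    rw [le_div_iff₀ (h.pos m)]; exact h.ge_mul m
  have hrec : ∀ m : ℕ, (m + 4 : ℝ) * (t (m + 1) - R)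
      = 3 * (β - R) + (m + 1) * (β ^ 2 - 4 * β) / (R * t m) * (t m - R) := by
    intro m
    have h3 := h.threeTerm m
    have p1 := h.pos m
    have p2 := h.pos (m + 1)
    have e1 : l (m + 2) = t m * l (m + 1) := by rw [ht]; field_simp
    have e2 : l (m + 3) = t (m + 1) * l (m + 2) := by rw [ht]; field_simp
    have htm : 0 < t m := by linarith [htβ m]
    rw [e2, e1] at h3
    have h4 : (m + 4 : ℝ) * t (m + 1) * t m = β * (2 * m + 5) * t m - (β ^ 2 - 4 * β) * (m + 1) := by
      apply mul_right_cancel₀ p1.ne'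
      linear_combination h3
    have hRq : R ^ 2 = 2 * β * R - (β ^ 2 - 4 * β) := by
      rw [hRw, ← hw2]; ring
    field_simp
    have : R ≠ 0 := hR.ne'
    linear_combination R * h4 + (-(m + 1 : ℝ) * t m) * hRq
  set κ := |1 - 2 / w| with hκ
  have hκ1 : κ < 1 := by
    rw [hκ, abs_lt]
    have : 0 < 2 / w := by positivity
    have : 2 / w < 2 := by rw [div_lt_iff₀ (by linarith)]; linarith
    constructor <;> linarith
  have hstep : ∀ m ≥ 0, |t (m + 1) - R| ≤ κ * |t m - R| + 3 * (R - β) * (1 / ((m : ℝ) + 1)) := by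
    intro m _
    have htm : 0 < t m := by linarith [htβ m]
    have h5 : t (m + 1) - R = 3 * (β - R) / (m + 4)
        + ((m + 1) / (m + 4)) * ((β ^ 2 - 4 * β) / (R * t m)) * (t m - R) := by
      have := hrec m
      field_simp
      field_simp at this
      linarith
    have hRβ : 0 < R - β := by rw [hRdef, RR, ← hw]; linarith
    have h6 : |3 * (β - R) / (m + 4 : ℝ)| ≤ 3 * (R - β) * (1 / ((m : ℝ) + 1)) := by
      rw [abs_div, abs_of_nonpos (by linarith), abs_of_pos (by positivity)]
      rw [mul_one_div]
      rw [div_le_div_iff₀ (by positivity) (by positivity)]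
      nlinarith
    have h7 : |(β ^ 2 - 4 * β) / (R * t m)| ≤ κ := by
      have e : (β ^ 2 - 4 * β) = (1 - 2 / w) * (R * β) := by
        rw [hRw, ← hw2]; field_simp; ring
      rw [abs_div, abs_of_pos (by positivity : 0 < R * t m), div_le_iff₀ (by positivity), e,
        abs_mul, abs_of_pos (by positivity : 0 < R * β)]
      exact mul_le_mul_of_nonneg_left (mul_le_mul_of_nonneg_left (htβ m) hR.le) (abs_nonneg _)
    have h8 : |((m : ℝ) + 1) / (m + 4)| ≤ 1 := by
      rw [abs_of_nonneg (by positivity), div_le_one (by positivity)]; linarith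
    rw [h5]
    refine (abs_add_le _ _).trans ?_
    rw [add_comm, abs_mul, abs_mul]
    refine add_le_add ?_ h6
    refine mul_le_mul_of_nonneg_right ?_ (abs_nonneg _)
    calc _ ≤ 1 * κ := mul_le_mul h8 h7 (abs_nonneg _) zero_le_one
      _ = κ := one_mul _
  have he : Tendsto (fun m : ℕ => 3 * (R - β) * (1 / ((m : ℝ) + 1))) atTop (𝓝 0) := by
    have := (tendsto_one_div_add_atTop_nhds_zero_nat (𝕜 := ℝ)).const_mul (3 * (R - β))
    rwa [mul_zero] at this
  have := contr_seq (abs_nonneg _) hκ1 (fun m => abs_nonneg (t m - R)) 0 he hstep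
  rw [tendsto_iff_dist_tendsto_zero]
  simpa [Real.dist_eq] using this

lemma ratio (h : Mot β l) : Tendsto (fun m => l (m + 1) / l m) atTop (𝓝 (RR β)) := by
  exact (tendsto_add_atTop_iff_nat 1).1 h.ratio_aux

lemma ratio_one (h : Mot β l) : Tendsto (fun m => l m / l (m + 1)) atTop (𝓝 (rho β)) := by
  have := h.ratio.inv₀ (RR_pos h.hβ).ne'
  simpa [rho] using this

/-- `l m / l (m + j) → ρ ^ j`. -/
lemma ratio_shift (h : Mot β l) (j : ℕ) :
    Tendsto (fun m => l m / l (m + j)) atTop (𝓝 (rho β ^ j)) := by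
  induction j with
  | zero =>
    simp only [add_zero, pow_zero]
    refine tendsto_const_nhds.congr' ?_
    filter_upwards [eventually_ge_atTop 1] with m hm
    rw [div_self (h.pos' hm).ne']
  | succ j ih =>
    have h1 := (tendsto_add_atTop_iff_nat j).2 h.ratio_one
    have h2 := ih.mul h1
    rw [pow_succ]
    refine h2.congr' ?_
    filter_upwards [eventually_ge_atTop 1] with m hm
    have p1 := h.pos' hm
    have p2 := h.pos' (show 1 ≤ m + j by omega)
    have p3 := h.pos' (show 1 ≤ m + j + 1 by omega)
    rw [← add_assoc]
    field_simp

lemma ratio_sub (h : Mot β l) (j : ℕ) :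
    Tendsto (fun m => l (m - j) / l m) atTop (𝓝 (rho β ^ j)) := by
  rw [← tendsto_add_atTop_iff_nat j]
  simpa using h.ratio_shift j

end Mot

/-- Split an antidiagonal sum into the two boundary parts and the middle. -/
lemma antidiag_split {V : Type*} [AddCommMonoid V] (F : ℕ × ℕ → V) (K m : ℕ) (hm : 2 * K ≤ m) :
    ∑ p ∈ antidiagonal m, F p = ∑ i ∈ range K, F (i, m - i) + ∑ j ∈ range K, F (m - j, j)
      + ∑ p ∈ (antidiagonal m).filter (fun p => K ≤ p.1 ∧ K ≤ p.2), F p := by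
  rw [← sum_filter_add_sum_filter_not (antidiagonal m) (fun p => p.1 < K)]
  rw [← sum_filter_add_sum_filter_not ((antidiagonal m).filter (fun p => ¬ p.1 < K))
    (fun p => p.2 < K)]
  rw [add_assoc]
  congr 1
  · refine sum_bij' (fun p _ => p.1) (fun i _ => (i, m - i)) ?_ ?_ ?_ ?_ ?_
    · simp
    · simp; intro a ha; omega
    · simp; intro a b hab hK; omega
    · simp
    · simp; intro a b hab hK; congr 2; omega
  congr 1
  · refine sum_bij' (fun p _ => p.2) (fun j _ => (m - j, j)) ?_ ?_ ?_ ?_ ?_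
    · simp
    · simp; intro a ha; omega
    · simp; intro a b hab hK; omega
    · simp
    · simp; intro a b hab hK hb; congr 2; omega
  · refine sum_congr ?_ (fun _ _ => rfl)
    ext p; simp; tauto

namespace Mot

variable {β : ℝ} {l : ℕ → ℝ}

lemma conv_lim (h : Mot β l) :
    Tendsto (fun m => (∑ p ∈ antidiagonal m, l p.1 * l p.2) / l m) atTop (𝓝 (2 * √β)) := by
  have h1 := h.ratio.sub_const β
  rw [show RR β - β = 2 * √β by unfold RR; ring] at h1
  refine h1.congr' ?_
  filter_upwards [eventually_ge_atTop 1] with m hm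
  obtain ⟨k, rfl⟩ : ∃ k, m = k + 1 := ⟨m - 1, by omega⟩
  have p := h.pos k
  have := h.rec' k
  rw [show k + 1 + 1 = k + 2 from rfl, this]
  field_simp
  ring

lemma partial_lim (h : Mot β l) (x : ℕ → ℝ) (K : ℕ) :
    Tendsto (fun m => (∑ i ∈ range K, x i * l (m - i)) / l m) atTop
      (𝓝 (∑ i ∈ range K, x i * rho β ^ i)) := by
  simp_rw [sum_div, mul_div_assoc]
  exact tendsto_finsetSum _ fun i _ => (h.ratio_sub i).const_mul _

lemma partial_le (h : Mot β l) (K : ℕ) : ∑ i ∈ range K, l i * rho β ^ i ≤ √β := by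
  have h1 := (h.partial_lim l K).const_mul 2
  have h2 := le_of_tendsto_of_tendsto h1 h.conv_lim (by
    filter_upwards [eventually_ge_atTop (2 * K + 1)] with m hm
    rw [← mul_div_assoc]
    refine div_le_div_of_nonneg_right ?_ (h.nonneg m)
    rw [antidiag_split _ K m (by omega), two_mul]
    have : 0 ≤ ∑ p ∈ (antidiagonal m).filter (fun p => K ≤ p.1 ∧ K ≤ p.2), l p.1 * l p.2 :=
      sum_nonneg fun p _ => mul_nonneg (h.nonneg _) (h.nonneg _)
    have e : ∑ i ∈ range K, l i * l (m - i) = ∑ j ∈ range K, l (m - j) * l j :=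
      sum_congr rfl fun i _ => mul_comm _ _
    simp only
    linarith)
  linarith

lemma summable (h : Mot β l) : Summable (fun i => l i * rho β ^ i) :=
  summable_of_sum_range_le (fun i => mul_nonneg (h.nonneg i) (pow_nonneg (rho_pos h.hβ).le _))
    h.partial_le

lemma tsum_eq (h : Mot β l) : ∑' i, l i * rho β ^ i = √β := by
  have hρ := rho_pos h.hβ
  have hs := h.summable
  set σ := ∑' i, l i * rho β ^ i with hσ
  have hn : ∀ i, 0 ≤ l i * rho β ^ i :=
    fun i => mul_nonneg (h.nonneg i) (pow_nonneg hρ.le _)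
  have hsn : Summable (fun i => ‖l i * rho β ^ i‖) := by
    simpa only [Real.norm_of_nonneg (hn _)] using hs
  have hmul := tsum_mul_tsum_eq_tsum_sum_antidiagonal_of_summable_norm hsn hsn
  have hsc := summable_norm_sum_mul_antidiagonal_of_summable_norm hsn hsn
  have hsc' := hsc.of_norm
  have hconv : ∀ m, ∑ kl ∈ antidiagonal m, l kl.1 * rho β ^ kl.1 * (l kl.2 * rho β ^ kl.2)
      = (∑ p ∈ antidiagonal m, l p.1 * l p.2) * rho β ^ m := by
    intro m
    rw [sum_mul]
    refine sum_congr rfl fun p hp => ?_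
    rw [← mem_antidiagonal.1 hp, pow_add]; ring
  simp_rw [hconv] at hmul hsc'
  rw [hsc'.tsum_eq_zero_add] at hmul
  have h0 : (∑ p ∈ antidiagonal 0, l p.1 * l p.2) * rho β ^ 0 = 0 := by simp [h.h0]
  rw [h0, zero_add] at hmul
  have hterm : ∀ m, (∑ p ∈ antidiagonal (m + 1), l p.1 * l p.2) * rho β ^ (m + 1)
      = RR β * (l (m + 2) * rho β ^ (m + 2)) - β * (l (m + 1) * rho β ^ (m + 1)) := by
    intro m
    have := h.rec' m
    have e : RR β * rho β = 1 := mul_inv_cancel₀ (RR_pos h.hβ).ne'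
    have e2 : RR β * (l (m + 2) * rho β ^ (m + 2)) = l (m + 2) * rho β ^ (m + 1) := by
      rw [pow_succ]
      linear_combination (l (m + 2) * rho β ^ (m + 1)) * e
    rw [e2, this]; ring
  simp_rw [hterm] at hmul
  have hs1 : Summable (fun m => l (m + 1) * rho β ^ (m + 1)) := (summable_nat_add_iff 1).2 hs
  have hs2 : Summable (fun m => l (m + 2) * rho β ^ (m + 2)) := (summable_nat_add_iff 2).2 hs
  rw [(hs2.mul_left _).tsum_sub (hs1.mul_left _), tsum_mul_left, tsum_mul_left] at hmul
  have t1 : σ = ∑' m, l (m + 1) * rho β ^ (m + 1) := by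
    rw [hσ, hs.tsum_eq_zero_add]; simp [h.h0]
  have t2 : σ = β * rho β + ∑' m, l (m + 2) * rho β ^ (m + 2) := by
    rw [t1, hs1.tsum_eq_zero_add]; simp [h.h1]
  rw [← t1, ← hσ] at hmul
  have e : RR β * rho β = 1 := mul_inv_cancel₀ (RR_pos h.hβ).ne'
  have t3 : ∑' m, l (m + 2) * rho β ^ (m + 2) = σ - β * rho β := by linarith
  rw [t3] at hmul
  have hw2 : √β ^ 2 = β := Real.sq_sqrt (by linarith [h.hβ])
  have : (σ - √β) ^ 2 = 0 := by
    have e3 : RR β * (σ - β * rho β) = RR β * σ - β := by linear_combination (-β) * e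
    rw [e3] at hmul
    unfold RR at hmul
    linear_combination hmul + hw2
  have := pow_eq_zero_iff (two_ne_zero) |>.1 this
  linarith

/-- One big jump. -/
lemma tail (h : Mot β l) {η : ℝ} (hη : 0 < η) : ∃ K₀ : ℕ, ∀ K ≥ K₀, ∀ᶠ m in atTop,
    ∑ p ∈ (antidiagonal m).filter (fun p => K ≤ p.1 ∧ K ≤ p.2), l p.1 * l p.2 ≤ η * l m := by
  have hs := h.summable.hasSum.tendsto_sum_nat
  rw [h.tsum_eq] at hs
  have : ∀ᶠ K in atTop, √β - η / 4 < ∑ i ∈ range K, l i * rho β ^ i :=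
    hs.eventually (lt_mem_nhds (by linarith))
  obtain ⟨K₀, hK₀⟩ := eventually_atTop.1 this
  refine ⟨K₀, fun K hK => ?_⟩
  have hK' := hK₀ K hK
  have h1 := (h.partial_lim l K).const_mul 2
  have h2 := h.conv_lim.sub h1
  have h3 := h2.eventually (gt_mem_nhds (show 2 * √β - 2 * (∑ i ∈ range K, l i * rho β ^ i) < η by
    linarith))
  filter_upwards [h3, eventually_ge_atTop (2 * K + 1)] with m hm1 hm2
  have p := h.pos' (show 1 ≤ m by omega)
  rw [← mul_div_assoc, ← sub_div, div_lt_iff₀ p, antidiag_split _ K m (by omega)] at hm1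
  have e : ∑ i ∈ range K, l i * l (m - i) = ∑ j ∈ range K, l (m - j) * l j :=
    sum_congr rfl fun i _ => mul_comm _ _
  simp only at hm1
  linarith

/-- Convolution asymptotics. -/
lemma conv (h : Mot β l) {x y : ℕ → ℝ} {a b X Y Cx Cy : ℝ}
    (hx0 : ∀ m, 0 ≤ x m) (hy0 : ∀ m, 0 ≤ y m)
    (hxC : ∀ m ≥ 1, x m ≤ Cx * l m) (hyC : ∀ m ≥ 1, y m ≤ Cy * l m)
    (hx : Tendsto (fun m => x m / l m) atTop (𝓝 a))
    (hy : Tendsto (fun m => y m / l m) atTop (𝓝 b))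
    (hX : HasSum (fun m => x m * rho β ^ m) X) (hY : HasSum (fun m => y m * rho β ^ m) Y) :
    Tendsto (fun m => (∑ p ∈ antidiagonal m, x p.1 * y p.2) / l m) atTop (𝓝 (a * Y + b * X)) := by
  have hCx : 0 ≤ Cx := by
    have := (hx0 1).trans (hxC 1 le_rfl)
    exact nonneg_of_mul_nonneg_left this (h.pos 0)
  have hCy : 0 ≤ Cy := by
    have := (hy0 1).trans (hyC 1 le_rfl)
    exact nonneg_of_mul_nonneg_left this (h.pos 0)
  rw [Metric.tendsto_atTop]
  intro ε hε
  set η := ε / (4 * (Cx * Cy + 1)) with hη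
  have hηpos : 0 < η := by positivity
  obtain ⟨K₀, hK₀⟩ := h.tail hηpos
  have hX' := hX.tendsto_sum_nat
  have hY' := hY.tendsto_sum_nat
  have hXY := (hY'.const_mul a).add (hX'.const_mul b)
  obtain ⟨K₁, hK₁⟩ := Metric.tendsto_atTop.1 hXY (ε / 4) (by positivity)
  set K := max (max K₀ K₁) 1 with hK
  have h1 := hK₀ K (by omega)
  have h2 := hK₁ K (by omega)
  have sx : ∀ j, Tendsto (fun m => x (m - j) / l m) atTop (𝓝 (a * rho β ^ j)) := by
    intro j
    have := (hx.comp (tendsto_sub_atTop_nat j)).mul (h.ratio_sub j)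
    refine this.congr' ?_
    filter_upwards [eventually_ge_atTop (j + 1)] with m hm
    have p := h.pos' (show 1 ≤ m - j by omega)
    simp only [Function.comp]
    field_simp
  have sy : ∀ j, Tendsto (fun m => y (m - j) / l m) atTop (𝓝 (b * rho β ^ j)) := by
    intro j
    have := (hy.comp (tendsto_sub_atTop_nat j)).mul (h.ratio_sub j)
    refine this.congr' ?_
    filter_upwards [eventually_ge_atTop (j + 1)] with m hm
    have p := h.pos' (show 1 ≤ m - j by omega)
    simp only [Function.comp]
    field_simp
  have t1 : Tendsto (fun m => ∑ i ∈ range K, x i * (y (m - i) / l m)) atTop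
      (𝓝 (∑ i ∈ range K, x i * (b * rho β ^ i))) :=
    tendsto_finsetSum _ fun i _ => (sy i).const_mul _
  have t2 : Tendsto (fun m => ∑ j ∈ range K, (x (m - j) / l m) * y j) atTop
      (𝓝 (∑ j ∈ range K, (a * rho β ^ j) * y j)) :=
    tendsto_finsetSum _ fun i _ => (sx i).mul_const _
  have e12 : ∑ i ∈ range K, x i * (b * rho β ^ i) + ∑ j ∈ range K, (a * rho β ^ j) * y j
      = a * ∑ i ∈ range K, y i * rho β ^ i + b * ∑ i ∈ range K, x i * rho β ^ i := by
    rw [mul_sum, mul_sum, add_comm]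
    congr 1 <;> exact sum_congr rfl fun i _ => by ring
  have t12 := t1.add t2
  rw [e12] at t12
  obtain ⟨M₁, hM₁⟩ := Metric.tendsto_atTop.1 t12 (ε / 4) (by positivity)
  obtain ⟨M₂, hM₂⟩ := eventually_atTop.1 h1
  refine ⟨max (max M₁ M₂) (2 * K + 1), fun m hm => ?_⟩
  have q1 := hM₁ m (by omega)
  have q2 := hM₂ m (by omega)
  have p := h.pos' (show 1 ≤ m by omega)
  rw [antidiag_split _ K m (by omega)]
  set T := ∑ p ∈ (antidiagonal m).filter (fun p => K ≤ p.1 ∧ K ≤ p.2), x p.1 * y p.2 with hT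
  have hT0 : 0 ≤ T := sum_nonneg fun p _ => mul_nonneg (hx0 _) (hy0 _)
  have hT1 : T / l m ≤ ε / 4 := by
    rw [div_le_iff₀ p]
    have : T ≤ Cx * Cy * ∑ p ∈ (antidiagonal m).filter (fun p => K ≤ p.1 ∧ K ≤ p.2), l p.1 * l p.2 := by
      rw [hT, mul_sum]
      refine sum_le_sum fun p hp => ?_
      simp only [mem_filter] at hp
      have a1 := hxC p.1 (by omega)
      have a2 := hyC p.2 (by omega)
      calc x p.1 * y p.2 ≤ (Cx * l p.1) * (Cy * l p.2) :=
            mul_le_mul a1 a2 (hy0 _) (mul_nonneg hCx (h.nonneg _))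
        _ = _ := by ring
    refine this.trans ?_
    have hcc : 0 ≤ Cx * Cy := mul_nonneg hCx hCy
    refine (mul_le_mul_of_nonneg_left q2 hcc).trans ?_
    have : Cx * Cy * η ≤ ε / 4 := by
      rw [hη]
      rw [mul_div_assoc', div_le_div_iff₀ (by positivity) (by positivity)]
      nlinarith
    nlinarith
  have hT2 : 0 ≤ T / l m := div_nonneg hT0 p.le
  rw [add_div, add_div, sum_div, sum_div]
  rw [Real.dist_eq, abs_lt] at *
  have e1 : ∑ i ∈ range K, x i * y (m - i) / l m = ∑ i ∈ range K, x i * (y (m - i) / l m) :=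
    sum_congr rfl fun i _ => by ring
  have e2 : ∑ i ∈ range K, x (m - i) * y i / l m = ∑ i ∈ range K, (x (m - i) / l m) * y i :=
    sum_congr rfl fun i _ => by ring
  simp only [e1, e2]
  constructor <;> linarith [q1.1, q1.2, h2.1, h2.2]

end Mot
end AndOr


namespace AndOr

open Filter Topology Finset

open PowerSeries (coeff)

lemma hsc {f g : ℕ → ℝ} {a : ℝ} (h : ∀ m, f m = g m) (hg : HasSum g a) : HasSum f a := by
  rw [funext h]; exact hg

/-- Asymptotics of a power series with nonnegative coefficients relative to `l`. -/
structure Asy (β : ℝ) (l : ℕ → ℝ) (P : PowerSeries ℝ) (a S : ℝ) : Prop where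
  nonneg : ∀ m, 0 ≤ coeff m P
  lim : Tendsto (fun m => coeff m P / l m) atTop (𝓝 a)
  sum : HasSum (fun m => coeff m P * rho β ^ m) S

namespace Asy

variable {β : ℝ} {l : ℕ → ℝ}

lemma bound (h : Mot β l) {P a S} (hP : Asy β l P a S) :
    ∃ K, ∀ m ≥ 1, coeff m P ≤ K * l m := by
  obtain ⟨K, hK⟩ := hP.lim.bddAbove_range
  refine ⟨K, fun m hm => ?_⟩
  have := hK ⟨m, rfl⟩
  simp only at this
  rwa [div_le_iff₀ (h.pos' hm)] at this

lemma mul (h : Mot β l) {P Q a b S T} (hP : Asy β l P a S) (hQ : Asy β l Q b T) :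
    Asy β l (P * Q) (a * T + b * S) (S * T) := by
  obtain ⟨K1, hK1⟩ := hP.bound h
  obtain ⟨K2, hK2⟩ := hQ.bound h
  refine ⟨fun m => ?_, ?_, ?_⟩
  · rw [PowerSeries.coeff_mul]
    exact sum_nonneg fun p _ => mul_nonneg (hP.nonneg _) (hQ.nonneg _)
  · simp_rw [PowerSeries.coeff_mul]
    exact h.conv (x := fun m => coeff m P) (y := fun m => coeff m Q) hP.nonneg hQ.nonneg hK1 hK2 hP.lim hQ.lim hP.sum hQ.sum
  · have hρ := rho_pos h.hβ
    have n1 : ∀ m, 0 ≤ coeff m P * rho β ^ m :=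
      fun m => mul_nonneg (hP.nonneg m) (pow_nonneg hρ.le _)
    have n2 : ∀ m, 0 ≤ coeff m Q * rho β ^ m :=
      fun m => mul_nonneg (hQ.nonneg m) (pow_nonneg hρ.le _)
    have s1 : Summable (fun m => ‖coeff m P * rho β ^ m‖) := by
      simpa only [Real.norm_of_nonneg (n1 _)] using hP.sum.summable
    have s2 : Summable (fun m => ‖coeff m Q * rho β ^ m‖) := by
      simpa only [Real.norm_of_nonneg (n2 _)] using hQ.sum.summable
    have e := tsum_mul_tsum_eq_tsum_sum_antidiagonal_of_summable_norm s1 s2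
    have hs := (summable_norm_sum_mul_antidiagonal_of_summable_norm s1 s2).of_norm.hasSum
    rw [← e, hP.sum.tsum_eq, hQ.sum.tsum_eq] at hs
    refine hsc (fun m => ?_) hs
    rw [PowerSeries.coeff_mul, sum_mul]
    refine sum_congr rfl fun p hp => ?_
    rw [← mem_antidiagonal.1 hp, pow_add]; ring

lemma one : Asy β l 1 0 1 := by
  refine ⟨fun m => ?_, ?_, ?_⟩
  · rw [PowerSeries.coeff_one]; split_ifs <;> norm_num
  · refine tendsto_const_nhds.congr' ?_
    filter_upwards [eventually_ge_atTop 1] with m hm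
    rw [PowerSeries.coeff_one, if_neg (by omega), zero_div]
  · have := hasSum_single (f := fun m => coeff m (1 : PowerSeries ℝ) * rho β ^ m) 0 (by
      intro m hm
      rw [PowerSeries.coeff_one, if_neg hm, zero_mul])
    simpa using this

lemma add {P Q a b S T} (hP : Asy β l P a S) (hQ : Asy β l Q b T) :
    Asy β l (P + Q) (a + b) (S + T) := by
  refine ⟨fun m => ?_, ?_, ?_⟩
  · rw [map_add]; exact add_nonneg (hP.nonneg m) (hQ.nonneg m)
  · simp_rw [map_add, add_div]; exact hP.lim.add hQ.lim
  · simp_rw [map_add, add_mul]; exact hP.sum.add hQ.sum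

lemma smul {P a S} (c : ℝ) (hc : 0 ≤ c) (hP : Asy β l P a S) :
    Asy β l (PowerSeries.C c * P) (c * a) (c * S) := by
  refine ⟨fun m => ?_, ?_, ?_⟩
  · rw [PowerSeries.coeff_C_mul]; exact mul_nonneg hc (hP.nonneg m)
  · simp_rw [PowerSeries.coeff_C_mul, mul_div_assoc]; exact hP.lim.const_mul _
  · simp_rw [PowerSeries.coeff_C_mul, mul_assoc]; exact hP.sum.mul_left _

lemma X_mul (h : Mot β l) {P a S} (hP : Asy β l P a S) :
    Asy β l (PowerSeries.X * P) (rho β * a) (rho β * S) := by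
  refine ⟨fun m => ?_, ?_, ?_⟩
  · rcases m with _ | m
    · simp
    · rw [PowerSeries.coeff_succ_X_mul]; exact hP.nonneg m
  · rw [← tendsto_add_atTop_iff_nat 1]
    simp_rw [PowerSeries.coeff_succ_X_mul]
    have := h.ratio_one.mul hP.lim
    refine this.congr' ?_
    filter_upwards [eventually_ge_atTop 1] with m hm
    have := h.pos' hm
    field_simp
  · rw [← hasSum_nat_add_iff' 1]
    simp_rw [PowerSeries.coeff_succ_X_mul]
    simp only [range_one, sum_singleton, PowerSeries.coeff_zero_X_mul, zero_mul, sub_zero]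
    refine hsc (fun m => ?_) (hP.sum.mul_left (rho β))
    rw [pow_succ]; ring

lemma base (h : Mot β l) : Asy β l (PowerSeries.mk l) 1 (√β) := by
  refine ⟨fun m => ?_, ?_, ?_⟩
  · simpa using h.nonneg m
  · simp only [PowerSeries.coeff_mk]
    refine tendsto_const_nhds.congr' ?_
    filter_upwards [eventually_ge_atTop 1] with m hm
    rw [div_self (h.pos' hm).ne']
  · simp only [PowerSeries.coeff_mk]
    rw [← h.tsum_eq]; exact h.summable.hasSum

lemma pow (h : Mot β l) {P a S} (hP : Asy β l P a S) (k : ℕ) :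
    Asy β l (P ^ (k + 1)) ((k + 1) * a * S ^ k) (S ^ (k + 1)) := by
  induction k with
  | zero => simpa using hP
  | succ k ih =>
    have := ih.mul h hP
    rw [pow_succ]
    convert this using 1
    · push_cast; ring
    · ring

lemma X_pow_mul (h : Mot β l) {P a S} (hP : Asy β l P a S) (s : ℕ) :
    Asy β l (PowerSeries.X ^ s * P) (rho β ^ s * a) (rho β ^ s * S) := by
  induction s with
  | zero => simpa using hP
  | succ s ih =>
    have := ih.X_mul h
    rw [pow_succ', mul_assoc, pow_succ', mul_assoc, mul_assoc]
    exact this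

end Asy
end AndOr


namespace AndOr

open Filter Topology Finset
open AT

/-- Boolean functions. -/
abbrev G (n : ℕ) := (Fin n → Bool) → Bool

variable {n : ℕ}

/-- binary connective on Boolean functions -/
def op (c : Bool) (h k : G n) : G n := fun x => if c then h x && k x else h x || k x

/-- literal function -/
def litf (p : Fin n × Bool) : G n := eval (AT.leaf p.1 p.2)

lemma evalList_cons (c : Bool) (t : AT n) (ts : List (AT n)) :
    evalList c (t :: ts) = op c (eval t) (evalList c ts) := by
  funext x; rw [evalList]; rfl

lemma eval_node (c : Bool) (ts : List (AT n)) : eval (AT.node c ts) = evalList c ts := by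
  funext x; rw [eval]

lemma sizeList_cons (t : AT n) (ts : List (AT n)) :
    sizeList (t :: ts) = size t + sizeList ts := by rw [sizeList]

lemma sizeList_nil : sizeList ([] : List (AT n)) = 0 := by rw [sizeList]

lemma size_leaf (i : Fin n) (b : Bool) : size (AT.leaf i b) = 1 := by rw [size]

lemma size_node (c : Bool) (ts : List (AT n)) : size (AT.node c ts) = 1 + sizeList ts := by
  rw [size]

lemma sizeList_append (xs ys : List (AT n)) :
    sizeList (xs ++ ys) = sizeList xs + sizeList ys := by
  induction xs with
  | nil => simp [sizeList_nil]
  | cons t ts ih => rw [List.cons_append, sizeList_cons, sizeList_cons, ih, add_assoc]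

lemma size_pos (t : AT n) : 1 ≤ size t := by
  cases t with
  | leaf i b => rw [size_leaf]
  | node c ts => rw [size_node]; omega

/-- valid list of children under connective `c` -/
def Good (c : Bool) (ts : List (AT n)) : Prop := ∀ t ∈ ts, WF t ∧ rootConn t ≠ some c

lemma good_nil (c : Bool) : Good c ([] : List (AT n)) := by simp [Good]

lemma good_cons {c : Bool} {t : AT n} {ts : List (AT n)} :
    Good c (t :: ts) ↔ (WF t ∧ rootConn t ≠ some c) ∧ Good c ts := by
  simp [Good]

lemma good_append {c : Bool} {xs ys : List (AT n)} :
    Good c (xs ++ ys) ↔ Good c xs ∧ Good c ys := by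
  simp only [Good, List.mem_append]
  constructor
  · intro h; exact ⟨fun t ht => h t (Or.inl ht), fun t ht => h t (Or.inr ht)⟩
  · rintro ⟨h1, h2⟩ t (ht | ht)
    · exact h1 t ht
    · exact h2 t ht

lemma wf_node_iff {c : Bool} {ts : List (AT n)} :
    WF (AT.node c ts) ↔ 2 ≤ ts.length ∧ Good c ts := by
  constructor
  · intro h
    cases h with
    | node _ _ h1 h2 h3 => exact ⟨h1, fun t ht => ⟨h2 t ht, h3 t ht⟩⟩
  · rintro ⟨h1, h2⟩
    exact WF.node c ts h1 (fun t ht => (h2 t ht).1) (fun t ht => (h2 t ht).2)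

/-- head of a valid list -/
lemma head_cases {c : Bool} {t : AT n} (h : WF t ∧ rootConn t ≠ some c) :
    (∃ p : Fin n × Bool, t = AT.leaf p.1 p.2) ∨
    (∃ us, t = AT.node (!c) us ∧ 2 ≤ us.length ∧ Good (!c) us) := by
  cases t with
  | leaf i b => exact Or.inl ⟨(i, b), rfl⟩
  | node d us =>
    right
    have hd : d = !c := by
      have h2 := h.2
      simp only [rootConn, ne_eq, Option.some.injEq] at h2
      cases c <;> cases d <;> simp_all
    subst hd
    exact ⟨us, rfl, wf_node_iff.1 h.1⟩

lemma good_leaf {c : Bool} (p : Fin n × Bool) :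
    WF (AT.leaf p.1 p.2) ∧ rootConn (AT.leaf p.1 p.2) ≠ some c :=
  ⟨WF.leaf _ _, by simp [rootConn]⟩

lemma good_node {c : Bool} {us : List (AT n)} (h1 : 2 ≤ us.length) (h2 : Good (!c) us) :
    WF (AT.node (!c) us) ∧ rootConn (AT.node (!c) us) ≠ some c :=
  ⟨wf_node_iff.2 ⟨h1, h2⟩, by simp [rootConn]⟩

/-- Valid lists with at least `k` entries and total size `m`. -/
def SS (k : ℕ) (c : Bool) (m : ℕ) : Set (List (AT n)) :=
  {ts | Good c ts ∧ k ≤ ts.length ∧ sizeList ts = m}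

lemma SS_finite (m : ℕ) : ∀ k c, (SS (n := n) k c m).Finite := by
  induction m using Nat.strong_induction_on with
  | _ m ih =>
  intro k c
  have hsub : SS (n := n) k c m ⊆ {[]} ∪
      ((⋃ j ∈ Set.Iio m, Set.image2 (fun p ts => AT.leaf (Prod.fst p) (Prod.snd p) :: ts)
        (Set.univ : Set (Fin n × Bool)) (SS 0 c j)) ∪
      (⋃ i ∈ Set.Iio m, ⋃ j ∈ Set.Iio m,
        Set.image2 (fun us ts => AT.node (!c) us :: ts) (SS 2 (!c) i) (SS 0 c j))) := by
    rintro ts ⟨h1, h2, h3⟩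
    cases ts with
    | nil => exact Or.inl rfl
    | cons t ts =>
      right
      rw [good_cons] at h1
      rw [sizeList_cons] at h3
      rcases head_cases h1.1 with ⟨p, rfl⟩ | ⟨us, rfl, hu1, hu2⟩
      · left
        rw [size_leaf] at h3
        simp only [Set.mem_iUnion]
        exact ⟨sizeList ts, by simp; omega, p, trivial, ts, ⟨h1.2, by omega, rfl⟩, rfl⟩
      · right
        rw [size_node] at h3
        simp only [Set.mem_iUnion]
        exact ⟨sizeList us, by simp; omega, sizeList ts, by simp; omega, us, ⟨hu2, hu1, rfl⟩,
          ts, ⟨h1.2, by omega, rfl⟩, rfl⟩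
  refine Set.Finite.subset ?_ hsub
  refine (Set.finite_singleton _).union (Set.Finite.union ?_ ?_)
  · exact (Set.finite_Iio m).biUnion fun j hj => Set.Finite.image2 _ Set.finite_univ (ih j hj _ _)
  · exact (Set.finite_Iio m).biUnion fun i hi => (Set.finite_Iio m).biUnion fun j hj =>
      Set.Finite.image2 _ (ih i hi _ _) (ih j hj _ _)

/-- finset version of `SS` -/
noncomputable def SF (n : ℕ) (k : ℕ) (c : Bool) (m : ℕ) : Finset (List (AT n)) :=
  (SS_finite m k c).toFinset

lemma mem_SF {k : ℕ} {c : Bool} {m : ℕ} {ts : List (AT n)} :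
    ts ∈ SF n k c m ↔ Good c ts ∧ k ≤ ts.length ∧ sizeList ts = m := by
  simp [SF, SS]

/-- value-counting vector -/
noncomputable def cnt {α : Type*} (s : Finset α) (p : α → G n) : G n → ℝ :=
  fun g => ∑ x ∈ s, if p x = g then 1 else 0

/-- convolution product of vectors with respect to a connective -/
noncomputable def mulc (c : Bool) (x y : G n → ℝ) : G n → ℝ :=
  fun g => ∑ h, ∑ k, if op c h k = g then x h * y k else 0

lemma mulc_cnt {α γ : Type*} (c : Bool) (s : Finset α) (p : α → G n) (t : Finset γ) (q : γ → G n) :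
    mulc c (cnt s p) (cnt t q) = cnt (s ×ˢ t) (fun z => op c (p z.1) (q z.2)) := by
  funext g
  unfold mulc cnt
  rw [sum_product]
  have : ∀ h k : G n, (if op c h k = g then
      (∑ x ∈ s, if p x = h then (1 : ℝ) else 0) * (∑ x ∈ t, if q x = k then 1 else 0) else 0)
      = ∑ a ∈ s, ∑ b ∈ t, if p a = h then (if q b = k then
          (if op c (p a) (q b) = g then (1 : ℝ) else 0) else 0) else 0 := by
    intro h k
    rw [sum_mul_sum]
    split_ifs with hg
    · refine sum_congr rfl fun a _ => sum_congr rfl fun b _ => ?_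
      by_cases h1 : p a = h <;> by_cases h2 : q b = k <;> simp [h1, h2, hg]
    · symm
      refine sum_eq_zero fun a _ => sum_eq_zero fun b _ => ?_
      by_cases h1 : p a = h <;> by_cases h2 : q b = k <;> simp [h1, h2, hg]
  simp_rw [this]
  have e1 : ∀ h : G n, ∑ k : G n, ∑ a ∈ s, ∑ b ∈ t, (if p a = h then (if q b = k then
          (if op c (p a) (q b) = g then (1 : ℝ) else 0) else 0) else 0)
      = ∑ a ∈ s, ∑ b ∈ t, if p a = h then
          (if op c (p a) (q b) = g then (1 : ℝ) else 0) else 0 := by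
    intro h
    rw [sum_comm]
    refine sum_congr rfl fun a _ => ?_
    rw [sum_comm]
    refine sum_congr rfl fun b _ => ?_
    by_cases h1 : p a = h <;> simp [h1]
  simp_rw [e1]
  rw [sum_comm]
  refine sum_congr rfl fun a _ => ?_
  rw [sum_comm]
  refine sum_congr rfl fun b _ => ?_
  simp

/-- vector of valid lists -/
noncomputable def V (n : ℕ) (k : ℕ) (c : Bool) (m : ℕ) : G n → ℝ := cnt (SF n k c m) (evalList c)

/-- vector of literals -/
noncomputable def lam (n : ℕ) : G n → ℝ := cnt (univ : Finset (Fin n × Bool)) litf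

lemma V_rec (k : ℕ) (c : Bool) (m : ℕ) :
    V n (k + 1) c (m + 1) = mulc c (lam n) (V n k c m)
      + ∑ p ∈ antidiagonal m, mulc c (V n 2 (!c) p.1) (V n k c p.2) := by
  unfold V lam
  simp_rw [mulc_cnt]
  funext g
  rw [Pi.add_apply, Finset.sum_apply]
  unfold cnt
  have hs := Finset.sum_sigma (antidiagonal m) (fun p => SF n 2 (!c) p.1 ×ˢ SF n k c p.2)
    (fun z => if op c (evalList (!c) z.2.1) (evalList c z.2.2) = g then (1 : ℝ) else 0)
  simp only at hs
  rw [← hs]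
  have hd := Finset.sum_disjSum ((univ : Finset (Fin n × Bool)) ×ˢ SF n k c m)
    ((antidiagonal m).sigma (fun p => SF n 2 (!c) p.1 ×ˢ SF n k c p.2))
    (Sum.elim (fun z => if op c (litf z.1) (evalList c z.2) = g then (1 : ℝ) else 0)
      (fun z => if op c (evalList (!c) z.2.1) (evalList c z.2.2) = g then (1 : ℝ) else 0))
  simp only [Sum.elim_inl, Sum.elim_inr] at hd
  rw [← hd]
  symm
  refine sum_bij (fun z _ => Sum.elim (fun z => AT.leaf z.1.1 z.1.2 :: z.2)
    (fun z => AT.node (!c) z.2.1 :: z.2.2) z) ?_ ?_ ?_ ?_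
  · rintro (⟨p, ts⟩ | ⟨⟨i, j⟩, us, ts⟩) hz
    · simp only [inl_mem_disjSum, mem_product, mem_univ, true_and, mem_SF] at hz
      simp only [Sum.elim_inl, mem_SF, good_cons, sizeList_cons, size_leaf, List.length_cons]
      exact ⟨⟨good_leaf p, hz.1⟩, by omega, by omega⟩
    · simp only [inr_mem_disjSum, mem_sigma, HasAntidiagonal.mem_antidiagonal, mem_product, mem_SF] at hz
      obtain ⟨hij, ⟨a1, a2, a3⟩, b1, b2, b3⟩ := hz
      simp only [Sum.elim_inr, mem_SF, good_cons, sizeList_cons, size_node, List.length_cons]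
      exact ⟨⟨good_node a2 a1, b1⟩, by omega, by omega⟩
  · rintro (⟨p, ts⟩ | ⟨⟨i, j⟩, us, ts⟩) hz (⟨p', ts'⟩ | ⟨⟨i', j'⟩, us', ts'⟩) hz' heq
    · simp only [Sum.elim_inl, List.cons.injEq, AT.leaf.injEq] at heq
      obtain ⟨⟨h1, h2⟩, rfl⟩ := heq
      rw [Prod.ext h1 h2]
    · simp at heq
    · simp at heq
    · simp only [inr_mem_disjSum, mem_sigma, HasAntidiagonal.mem_antidiagonal, mem_product, mem_SF] at hz hz'
      obtain ⟨hij, ⟨a1, a2, a3⟩, b1, b2, b3⟩ := hz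
      obtain ⟨hij', ⟨a1', a2', a3'⟩, b1', b2', b3'⟩ := hz'
      simp only [Sum.elim_inr, List.cons.injEq, AT.node.injEq, true_and] at heq
      obtain ⟨rfl, rfl⟩ := heq
      subst a3 a3' b3 b3'
      rfl
  · intro ts hts
    rw [mem_SF] at hts
    obtain ⟨h1, h2, h3⟩ := hts
    cases ts with
    | nil => simp at h2
    | cons t ts =>
      rw [good_cons] at h1
      rw [sizeList_cons] at h3
      rw [List.length_cons] at h2
      rcases head_cases h1.1 with ⟨p, rfl⟩ | ⟨us, rfl, hu1, hu2⟩
      · rw [size_leaf] at h3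
        refine ⟨Sum.inl (p, ts), ?_, rfl⟩
        simp only [inl_mem_disjSum, mem_product, mem_univ, true_and, mem_SF]
        exact ⟨h1.2, by omega, by omega⟩
      · rw [size_node] at h3
        refine ⟨Sum.inr ⟨(sizeList us, sizeList ts), us, ts⟩, ?_, rfl⟩
        simp only [inr_mem_disjSum, mem_sigma, HasAntidiagonal.mem_antidiagonal, mem_product, mem_SF]
        exact ⟨by omega, ⟨hu2, hu1, trivial⟩, h1.2, by omega, trivial⟩
  · rintro (⟨p, ts⟩ | ⟨⟨i, j⟩, us, ts⟩) hz
    · simp only [Sum.elim_inl, evalList_cons]; rfl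
    · simp only [Sum.elim_inr, evalList_cons, eval_node]

lemma V_zero (k : ℕ) (c : Bool) : V n (k + 1) c 0 = 0 := by
  have : SF n (k + 1) c 0 = ∅ := by
    rw [eq_empty_iff_forall_notMem]
    intro ts hts
    rw [mem_SF] at hts
    obtain ⟨_, h2, h3⟩ := hts
    cases ts with
    | nil => simp at h2
    | cons t ts => rw [sizeList_cons] at h3; have := size_pos t; omega
  unfold V cnt
  rw [this]; rfl

/-- neutral element -/
def unitf (c : Bool) : G n := fun _ => c

lemma op_unitf (c : Bool) (h : G n) : op c h (unitf c) = h := by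
  funext x; cases c <;> simp [op, unitf]

lemma SF_zero (c : Bool) : SF n 0 c 0 = {[]} := by
  ext ts
  rw [mem_SF, mem_singleton]
  constructor
  · rintro ⟨_, _, h⟩
    cases ts with
    | nil => rfl
    | cons t ts => rw [sizeList_cons] at h; have := size_pos t; omega
  · rintro rfl; exact ⟨good_nil c, le_rfl, sizeList_nil⟩

lemma SF_succ (c : Bool) (m : ℕ) : SF n 0 c (m + 1) = SF n 1 c (m + 1) := by
  ext ts
  rw [mem_SF, mem_SF]
  constructor
  · rintro ⟨h1, _, h⟩
    refine ⟨h1, ?_, h⟩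
    cases ts with
    | nil => rw [sizeList_nil] at h; omega
    | cons t ts => simp
  · rintro ⟨h1, _, h⟩; exact ⟨h1, by omega, h⟩

lemma V0_zero (c : Bool) : V n 0 c 0 = Pi.single (unitf c) 1 := by
  unfold V cnt
  rw [SF_zero]
  funext g
  rw [sum_singleton]
  have : evalList c ([] : List (AT n)) = unitf c := by funext x; rw [evalList]; rfl
  rw [this, Pi.single_apply]
  simp only [eq_comm]

lemma V0_succ (c : Bool) (m : ℕ) : V n 0 c (m + 1) = V n 1 c (m + 1) := by
  unfold V; rw [SF_succ]

lemma mulc_unit (c : Bool) (x : G n → ℝ) : mulc c x (Pi.single (unitf c) 1) = x := by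
  funext g
  unfold mulc
  have : ∀ h : G n, ∑ k : G n, (if op c h k = g then x h * (Pi.single (unitf c) (1 : ℝ) : G n → ℝ) k else 0)
      = if h = g then x h else 0 := by
    intro h
    rw [sum_eq_single (unitf c)]
    · rw [op_unitf]; simp
    · intro k _ hk; simp [hk]
    · simp
  simp_rw [this]
  simp

lemma mulc_add_right (c : Bool) (x y z : G n → ℝ) : mulc c x (y + z) = mulc c x y + mulc c x z := by
  funext g
  simp only [mulc, Pi.add_apply, ← sum_add_distrib]
  refine sum_congr rfl fun h _ => sum_congr rfl fun k _ => ?_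
  split_ifs <;> ring

/-- `e(m+1) = f(m+1) + f'(m) + [m=0] λ`. -/
lemma V1_eq (c : Bool) (m : ℕ) :
    V n 1 c (m + 1) = V n 2 c (m + 1) + V n 2 (!c) m + if m = 0 then lam n else 0 := by
  rw [V_rec 0 c m, V_rec 1 c m]
  have key : ∀ j, V n 0 c j = V n 1 c j + if j = 0 then Pi.single (unitf c) 1 else 0 := by
    intro j
    cases j with
    | zero => rw [V0_zero, V_zero]; simp
    | succ j => rw [V0_succ]; simp
  simp_rw [key, mulc_add_right, sum_add_distrib]
  have e1 : mulc c (lam n) (if m = 0 then Pi.single (unitf c) 1 else 0)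
      = if m = 0 then lam n else 0 := by
    split_ifs
    · exact mulc_unit c _
    · funext g; simp [mulc]
  have e2 : ∑ p ∈ antidiagonal m, mulc c (V n 2 (!c) p.1)
      (if p.2 = 0 then Pi.single (unitf c) 1 else 0) = V n 2 (!c) m := by
    rw [sum_eq_single (m, 0)]
    · simp [mulc_unit]
    · rintro ⟨i, j⟩ hp hne
      rw [HasAntidiagonal.mem_antidiagonal] at hp
      have : j ≠ 0 := by rintro rfl; simp at hp; exact hne (by rw [hp])
      simp only [this, if_false]
      funext g; simp [mulc]
    · simp
  rw [e1, e2]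
  abel

end AndOr


namespace AndOr

open Filter Topology Finset
open AT

variable {n : ℕ}

/-- total mass -/
noncomputable def tot (x : G n → ℝ) : ℝ := ∑ g, x g

lemma tot_add (x y : G n → ℝ) : tot (x + y) = tot x + tot y := by
  simp [tot, sum_add_distrib]

lemma tot_sum {ι : Type*} (s : Finset ι) (x : ι → G n → ℝ) :
    tot (∑ i ∈ s, x i) = ∑ i ∈ s, tot (x i) := by
  simp only [tot, Finset.sum_apply]
  rw [sum_comm]

lemma tot_cnt {α : Type*} (s : Finset α) (p : α → G n) : tot (cnt s p) = s.card := by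
  unfold tot cnt
  rw [sum_comm]
  simp

lemma tot_mulc (c : Bool) (x y : G n → ℝ) : tot (mulc c x y) = tot x * tot y := by
  unfold tot mulc
  rw [sum_comm, sum_mul_sum]
  refine sum_congr rfl fun h _ => ?_
  rw [sum_comm]
  refine sum_congr rfl fun k _ => ?_
  simp

lemma tot_zero : tot (0 : G n → ℝ) = 0 := by simp [tot]

lemma tot_lam : tot (lam n) = 2 * n := by
  unfold lam; rw [tot_cnt]; simp; ring

lemma bb_rec (c : Bool) (m : ℕ) : tot (V n 2 c (m + 1)) = 2 * n * tot (V n 1 c m)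
    + ∑ p ∈ antidiagonal m, tot (V n 2 (!c) p.1) * tot (V n 1 c p.2) := by
  rw [V_rec 1 c m, tot_add, tot_mulc, tot_sum, tot_lam]
  simp_rw [tot_mulc]

lemma ll_rec (c : Bool) (m : ℕ) : tot (V n 1 c (m + 1)) = tot (V n 2 c (m + 1))
    + tot (V n 2 (!c) m) + if m = 0 then 2 * (n : ℝ) else 0 := by
  rw [V1_eq c m, tot_add, tot_add]
  congr 1
  split_ifs
  · exact tot_lam
  · exact tot_zero

attribute [irreducible] tot

lemma tot_indep (m : ℕ) : ∀ j ≤ m, tot (V n 2 true j) = tot (V n 2 false j) ∧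
    tot (V n 1 true j) = tot (V n 1 false j) := by
  induction m with
  | zero =>
    intro j hj
    obtain rfl : j = 0 := by omega
    simp only [V_zero, and_self]
  | succ m ih =>
    intro j hj
    rcases Nat.lt_or_ge j (m + 1) with h | h
    · exact ih j (by omega)
    obtain rfl : j = m + 1 := by omega
    have h2 : tot (V n 2 true (m + 1)) = tot (V n 2 false (m + 1)) := by
      rw [bb_rec, bb_rec, (ih m le_rfl).2]
      refine congrArg₂ (· + ·) rfl (sum_congr rfl fun p hp => ?_)
      rw [HasAntidiagonal.mem_antidiagonal] at hp
      simp only [Bool.not_true, Bool.not_false]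
      rw [(ih p.1 (by omega)).1, (ih p.2 (by omega)).2]
    refine ⟨h2, ?_⟩
    rw [ll_rec, ll_rec, h2]
    simp only [Bool.not_true, Bool.not_false]
    rw [(ih m le_rfl).1]

/-- number of valid lists with at least two entries -/
noncomputable def bb (n m : ℕ) : ℝ := tot (V n 2 true m)
/-- number of nonempty valid lists -/
noncomputable def ll (n m : ℕ) : ℝ := tot (V n 1 true m)

lemma tot_bb (c : Bool) (m : ℕ) : tot (V n 2 c m) = bb n m := by
  cases c
  · exact (tot_indep m m le_rfl).1.symm
  · rfl

lemma tot_ll (c : Bool) (m : ℕ) : tot (V n 1 c m) = ll n m := by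
  cases c
  · exact (tot_indep m m le_rfl).2.symm
  · rfl

lemma card_bb (c : Bool) (m : ℕ) : ((SF n 2 c m).card : ℝ) = bb n m := by
  rw [← tot_bb c m, V, tot_cnt]

lemma card_ll (c : Bool) (m : ℕ) : ((SF n 1 c m).card : ℝ) = ll n m := by
  rw [← tot_ll c m, V, tot_cnt]

lemma bb_nonneg (m : ℕ) : 0 ≤ bb n m := by rw [← card_bb true]; positivity
lemma ll_nonneg (m : ℕ) : 0 ≤ ll n m := by rw [← card_ll true]; positivity

lemma bb_zero : bb n 0 = 0 := by unfold bb; rw [V_zero, tot_zero]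
lemma ll_zero : ll n 0 = 0 := by unfold ll; rw [V_zero, tot_zero]

lemma bb_succ (m : ℕ) : bb n (m + 1) = 2 * n * ll n m
    + ∑ p ∈ antidiagonal m, bb n p.1 * ll n p.2 := by
  rw [← tot_bb true, bb_rec]
  simp_rw [tot_bb, tot_ll]

lemma ll_succ (m : ℕ) : ll n (m + 1) = bb n (m + 1)
    + bb n m + if m = 0 then 2 * (n : ℝ) else 0 := by
  rw [← tot_ll true, ll_rec]
  simp_rw [tot_bb]

open PowerSeries in
lemma LB : (PowerSeries.mk (ll n) : PowerSeries ℝ) = PowerSeries.mk (bb n) + X * PowerSeries.mk (bb n) + C (2 * (n : ℝ)) * X := by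
  ext m
  rcases m with _ | m
  · simp [ll_zero, bb_zero]
  · rw [map_add, map_add, coeff_succ_X_mul, coeff_mk, coeff_mk, coeff_mk, ll_succ, coeff_C_mul,
      coeff_X]
    congr 1
    rcases m with _ | m <;> simp

open PowerSeries in
lemma BL : (PowerSeries.mk (bb n) : PowerSeries ℝ) = X * (C (2 * (n : ℝ)) * PowerSeries.mk (ll n) + PowerSeries.mk (bb n) * PowerSeries.mk (ll n)) := by
  ext m
  rcases m with _ | m
  · simp [bb_zero]
  · rw [coeff_succ_X_mul, map_add, coeff_C_mul, coeff_mul]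
    simp_rw [coeff_mk]
    exact bb_succ m

open PowerSeries in
lemma LL : (PowerSeries.mk (ll n) : PowerSeries ℝ) = C (2 * (n : ℝ)) * X + X * (C (2 * (n : ℝ)) * PowerSeries.mk (ll n)
    + PowerSeries.mk (ll n) * PowerSeries.mk (ll n)) := by
  have h1 := LB (n := n)
  have h2 := BL (n := n)
  linear_combination (1 - X * PowerSeries.mk (ll n)) * h1 + (1 + X) * h2

lemma mot (hn : 1 ≤ n) : Mot (2 * (n : ℝ)) (ll n) := by
  have hL := LL (n := n)
  have hn' : (1 : ℝ) ≤ n := by exact_mod_cast hn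
  refine ⟨by linarith, ll_nonneg, ll_zero, ?_, ?_⟩
  · have h1 := ll_succ (n := n) 0
    rw [bb_succ] at h1
    simpa [ll_zero, bb_zero] using h1
  · intro m
    have := congrArg (PowerSeries.coeff (m + 2)) hL
    rw [map_add, PowerSeries.coeff_succ_X_mul, map_add, PowerSeries.coeff_C_mul,
      PowerSeries.coeff_C_mul, PowerSeries.coeff_mul, PowerSeries.coeff_X] at this
    simp_rw [PowerSeries.coeff_mk] at this
    simpa using this

/-- the asymptotics of `B` -/
lemma asyB (hn : 1 ≤ n) : Asy (2 * (n : ℝ)) (ll n) (PowerSeries.mk (bb n)) (1 + rho (2 * n))⁻¹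
    ((√(2 * n) - 2 * n * rho (2 * n)) / (1 + rho (2 * n))) := by
  have h := mot hn
  have hρ : 0 < rho (2 * (n : ℝ)) := rho_pos h.hβ
  have hρ1 : rho (2 * (n : ℝ)) < 1 := by
    unfold rho
    apply inv_lt_one_of_one_lt₀
    unfold RR
    have := h.hβ
    have := Real.sqrt_nonneg (2 * (n : ℝ))
    linarith
  have hble : ∀ m, bb n m ≤ ll n m := by
    intro m
    rcases m with _ | m
    · rw [bb_zero, ll_zero]
    · rw [ll_succ]
      have := bb_nonneg (n := n) m
      have : (0 : ℝ) ≤ if m = 0 then 2 * (n : ℝ) else 0 := by split_ifs <;> positivity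
      linarith
  have hlim : Tendsto (fun m => bb n m / ll n m) atTop (𝓝 (1 + rho (2 * n))⁻¹) := by
    rw [tendsto_iff_dist_tendsto_zero]
    simp_rw [Real.dist_eq]
    refine contr_seq (q := rho (2 * n)) (e := fun m => |ll n m / ll n (m + 1) - rho (2 * n)|)
      hρ.le hρ1 (fun m => abs_nonneg _) 1 ?_ ?_
    · have := (h.ratio_one).sub_const (rho (2 * (n : ℝ)))
      rw [sub_self] at this
      simpa using this.abs
    · intro m hm
      have hp1 := h.pos' (m := m) hm
      have hp2 := h.pos' (m := m + 1) (by omega)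
      have e1 : bb n (m + 1) / ll n (m + 1) = 1 - bb n m / ll n m * (ll n m / ll n (m + 1)) := by
        have := ll_succ (n := n) m
        rw [if_neg (by omega)] at this
        field_simp
        linarith
      have e2 : (1 + rho (2 * (n : ℝ)))⁻¹ = 1 - rho (2 * n) * (1 + rho (2 * (n : ℝ)))⁻¹ := by
        have : 1 + rho (2 * (n : ℝ)) ≠ 0 := by positivity
        field_simp
        ring
      have e3 : bb n (m + 1) / ll n (m + 1) - (1 + rho (2 * (n : ℝ)))⁻¹
        = - (rho (2 * n) * (bb n m / ll n m - (1 + rho (2 * (n : ℝ)))⁻¹))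
          - (bb n m / ll n m) * (ll n m / ll n (m + 1) - rho (2 * n)) := by
        rw [e1]; linear_combination -e2
      rw [e3]
      refine (abs_sub _ _).trans ?_
      rw [abs_neg, abs_mul, abs_of_pos hρ, abs_mul]
      have : |bb n m / ll n m| ≤ 1 := by
        rw [abs_of_nonneg (div_nonneg (bb_nonneg _) (ll_nonneg _))]
        rw [div_le_one hp1]; exact hble m
      have h0 := abs_nonneg (ll n m / ll n (m + 1) - rho (2 * (n : ℝ)))
      nlinarith
  have hnn : ∀ m, 0 ≤ PowerSeries.coeff m (PowerSeries.mk (bb n)) := by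
    intro m; rw [PowerSeries.coeff_mk]; exact bb_nonneg m
  have hbase := Asy.base h
  have hsm : Summable (fun m => PowerSeries.coeff m (PowerSeries.mk (bb n)) * rho (2 * n) ^ m) := by
    refine Summable.of_nonneg_of_le (fun m => mul_nonneg (hnn m) (by positivity)) ?_
      hbase.sum.summable
    intro m
    rw [PowerSeries.coeff_mk, PowerSeries.coeff_mk]
    gcongr
    exact hble m
  have hA : Asy (2 * (n : ℝ)) (ll n) (PowerSeries.mk (bb n)) (1 + rho (2 * n))⁻¹ _ :=
    ⟨hnn, by simpa using hlim, hsm.hasSum⟩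
  have hS := (((hA.add (hA.X_mul h)).add ((Asy.one.X_mul h).smul (2 * n) (by positivity))).sum)
  rw [mul_one PowerSeries.X, ← LB] at hS
  have := hS.unique hbase.sum
  refine ⟨hnn, hA.lim, ?_⟩
  convert hA.sum using 1
  rw [div_eq_iff (by positivity)]
  linarith

open Classical in
/-- counting trees of size at least two -/
lemma countIn_eq (𝒯 : Set (AT n)) (m : ℕ) (hm : 1 ≤ m) :
    countIn n 𝒯 (m + 1) = ((SF n 2 true m).filter (fun ts => AT.node true ts ∈ 𝒯)).card
      + ((SF n 2 false m).filter (fun ts => AT.node false ts ∈ 𝒯)).card := by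
  unfold countIn
  have hinj : ∀ c, Function.Injective (fun ts : List (AT n) => AT.node c ts) := by
    intro c a b h; simpa using h
  rw [Nat.subtype_card ((((SF n 2 true m).filter (fun ts => AT.node true ts ∈ 𝒯)).image (AT.node true))
    ∪ (((SF n 2 false m).filter (fun ts => AT.node false ts ∈ 𝒯)).image (AT.node false)))]
  · rw [card_union_of_disjoint, card_image_of_injective _ (hinj true),
      card_image_of_injective _ (hinj false)]
    rw [disjoint_left]
    intro t h1 h2
    rw [mem_image] at h1 h2
    obtain ⟨a, _, rfl⟩ := h1
    obtain ⟨b, _, h⟩ := h2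
    simp at h
  · intro t
    simp only [mem_union, mem_image, mem_filter, mem_SF]
    constructor
    · rintro (⟨ts, ⟨⟨h1, h2, h3⟩, h4⟩, rfl⟩ | ⟨ts, ⟨⟨h1, h2, h3⟩, h4⟩, rfl⟩)
      · exact ⟨h4, wf_node_iff.2 ⟨h2, h1⟩, by rw [size_node, h3]; omega⟩
      · exact ⟨h4, wf_node_iff.2 ⟨h2, h1⟩, by rw [size_node, h3]; omega⟩
    · rintro ⟨h1, h2, h3⟩
      cases t with
      | leaf i b => rw [size_leaf] at h3; omega
      | node c ts =>
        rw [size_node] at h3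
        rw [wf_node_iff] at h2
        cases c
        · exact Or.inr ⟨ts, ⟨⟨h2.2, h2.1, by omega⟩, h1⟩, rfl⟩
        · exact Or.inl ⟨ts, ⟨⟨h2.2, h2.1, by omega⟩, h1⟩, rfl⟩

lemma A_eq (m : ℕ) (hm : 1 ≤ m) : (A n (m + 1) : ℝ) = 2 * bb n m := by
  classical
  unfold A
  rw [countIn_eq _ m hm]
  simp only [Set.mem_univ, filter_true]
  push_cast
  rw [card_bb, card_bb]; ring

lemma count_eval (m : ℕ) (hm : 1 ≤ m) (g : G n) : (countIn n {t | eval t = g} (m + 1) : ℝ)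
    = V n 2 true m g + V n 2 false m g := by
  classical
  rw [countIn_eq _ m hm]
  push_cast
  unfold V cnt
  simp only [Set.mem_ofPred_eq, eval_node, sum_boole]

end AndOr


namespace AndOr

open Filter Topology Finset
open AT

variable {n : ℕ}

/-- the `ℓ¹` norm -/
noncomputable def NN (x : G n → ℝ) : ℝ := ∑ g, |x g|

lemma NN_nonneg (x : G n → ℝ) : 0 ≤ NN x := sum_nonneg fun _ _ => abs_nonneg _

lemma NN_add (x y : G n → ℝ) : NN (x + y) ≤ NN x + NN y := by
  unfold NN
  rw [← sum_add_distrib]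
  exact sum_le_sum fun g _ => abs_add_le _ _

lemma NN_smul (a : ℝ) (x : G n → ℝ) : NN (a • x) = |a| * NN x := by
  unfold NN
  rw [mul_sum]
  exact sum_congr rfl fun g _ => by rw [Pi.smul_apply, smul_eq_mul, abs_mul]

lemma NN_neg (x : G n → ℝ) : NN (-x) = NN x := by simp [NN]

lemma NN_sub (x y : G n → ℝ) : NN (x - y) ≤ NN x + NN y := by
  rw [sub_eq_add_neg, ← NN_neg y]; exact NN_add _ _

lemma NN_zero : NN (0 : G n → ℝ) = 0 := by simp [NN]

lemma NN_sum {ι : Type*} (s : Finset ι) (x : ι → G n → ℝ) :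
    NN (∑ i ∈ s, x i) ≤ ∑ i ∈ s, NN (x i) := by
  classical
  induction s using Finset.induction_on with
  | empty => simp [NN_zero]
  | insert a s ha ih =>
    rw [sum_insert ha, sum_insert ha]
    exact (NN_add _ _).trans (by linarith)

lemma abs_le_NN (x : G n → ℝ) (g : G n) : |x g| ≤ NN x :=
  single_le_sum (f := fun g => |x g|) (fun _ _ => abs_nonneg _) (mem_univ g)

lemma NN_of_nonneg {x : G n → ℝ} (hx : ∀ g, 0 ≤ x g) : NN x = tot x := by
  unfold NN tot
  exact sum_congr rfl fun g _ => abs_of_nonneg (hx g)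

lemma V_nonneg (k : ℕ) (c : Bool) (m : ℕ) (g : G n) : 0 ≤ V n k c m g := by
  unfold V cnt
  exact sum_nonneg fun _ _ => by split_ifs <;> norm_num

lemma lam_nonneg (g : G n) : 0 ≤ lam n g := by
  unfold lam cnt
  exact sum_nonneg fun _ _ => by split_ifs <;> norm_num

lemma NN_V2 (c : Bool) (m : ℕ) : NN (V n 2 c m) = bb n m := by
  rw [NN_of_nonneg (V_nonneg 2 c m), tot_bb]

lemma NN_V1 (c : Bool) (m : ℕ) : NN (V n 1 c m) = ll n m := by
  rw [NN_of_nonneg (V_nonneg 1 c m), tot_ll]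

lemma NN_lam : NN (lam n) = 2 * n := by rw [NN_of_nonneg lam_nonneg, tot_lam]

lemma mulc_smul_left (c : Bool) (a : ℝ) (x y : G n → ℝ) : mulc c (a • x) y = a • mulc c x y := by
  funext g
  simp only [mulc, Pi.smul_apply, smul_eq_mul, mul_sum]
  refine sum_congr rfl fun h _ => sum_congr rfl fun k _ => ?_
  split_ifs <;> ring

lemma mulc_smul_right (c : Bool) (a : ℝ) (x y : G n → ℝ) : mulc c x (a • y) = a • mulc c x y := by
  funext g
  simp only [mulc, Pi.smul_apply, smul_eq_mul, mul_sum]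
  refine sum_congr rfl fun h _ => sum_congr rfl fun k _ => ?_
  split_ifs <;> ring

lemma mulc_sub_right (c : Bool) (x y z : G n → ℝ) : mulc c x (y - z) = mulc c x y - mulc c x z := by
  funext g
  simp only [mulc, Pi.sub_apply, ← sum_sub_distrib]
  refine sum_congr rfl fun h _ => sum_congr rfl fun k _ => ?_
  split_ifs <;> ring

lemma mulc_sub_left (c : Bool) (x y z : G n → ℝ) : mulc c (x - y) z = mulc c x z - mulc c y z := by
  funext g
  simp only [mulc, Pi.sub_apply, ← sum_sub_distrib]
  refine sum_congr rfl fun h _ => sum_congr rfl fun k _ => ?_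
  split_ifs <;> ring

lemma NN_mulc (c : Bool) (x y : G n → ℝ) : NN (mulc c x y) ≤ NN x * NN y := by
  have h1 : ∀ g, |mulc c x y g| ≤ mulc c (fun h => |x h|) (fun h => |y h|) g := by
    intro g
    unfold mulc
    refine (abs_sum_le_sum_abs _ _).trans (sum_le_sum fun h _ => ?_)
    refine (abs_sum_le_sum_abs _ _).trans (sum_le_sum fun k _ => ?_)
    split_ifs
    · rw [abs_mul]
    · simp
  calc NN (mulc c x y) ≤ tot (mulc c (fun h => |x h|) (fun h => |y h|)) := by
        unfold NN tot; exact sum_le_sum fun g _ => h1 g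
    _ = NN x * NN y := by rw [tot_mulc]; unfold tot NN; rfl

/-- absorbing element -/
def absf (c : Bool) : G n := fun _ => !c

lemma op_absf (c : Bool) (h : G n) : op c h (absf c) = absf c := by
  funext x; cases c <;> simp [op, absf]

lemma mulc_abs (c : Bool) (d : G n → ℝ) (a : ℝ) :
    mulc c d (Pi.single (absf c) a) = (tot d * a) • Pi.single (absf c) 1 := by
  funext g
  unfold mulc
  have : ∀ h : G n, ∑ k : G n, (if op c h k = g then d h * (Pi.single (absf c) a : G n → ℝ) k else 0)
      = d h * (a * (Pi.single (absf c) (1 : ℝ) : G n → ℝ) g) := by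
    intro h
    rw [sum_eq_single (absf c)]
    · rw [op_absf]; simp only [Pi.single_apply, eq_comm]; split_ifs <;> simp
    · intro k _ hk; simp [hk]
    · simp
  simp_rw [this]
  rw [← sum_mul]
  simp [tot, mul_assoc]

lemma NN_single (g : G n) (a : ℝ) : NN (Pi.single g a : G n → ℝ) = |a| := by
  unfold NN
  rw [sum_eq_single g]
  · simp
  · intro h _ hh; simp [hh]
  · simp

/-- improved estimate -/
lemma NN_mulc' (c : Bool) (d y : G n → ℝ) :
    NN (mulc c d y) ≤ NN d * (NN y - |y (absf c)|) + |tot d| * |y (absf c)| := by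
  have e : y = (y - Pi.single (absf c) (y (absf c))) + Pi.single (absf c) (y (absf c)) := by abel
  have e2 : NN (y - Pi.single (absf c) (y (absf c))) = NN y - |y (absf c)| := by
    unfold NN
    rw [← add_sum_erase univ _ (mem_univ (absf c)), ← add_sum_erase univ (fun g => |y g|)
      (mem_univ (absf c))]
    simp only [Pi.sub_apply, Pi.single_eq_same, sub_self, abs_zero, zero_add, add_sub_cancel_left]
    refine sum_congr rfl fun g hg => ?_
    rw [Pi.single_eq_of_ne (ne_of_mem_erase hg), sub_zero]
  have e3 : mulc c d y = mulc c d (y - Pi.single (absf c) (y (absf c)))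
      + mulc c d (Pi.single (absf c) (y (absf c))) := by
    rw [← mulc_add_right, ← e]
  rw [e3]
  refine (NN_add _ _).trans (add_le_add ((NN_mulc _ _ _).trans_eq (by rw [e2])) ?_)
  rw [mulc_abs, NN_smul, NN_single, abs_mul]
  simp

/-- pairs of large integers -/
abbrev FF : Filter (ℕ × ℕ) := atTop ×ˢ atTop

/-- oscillation bound -/
def Osc (x : ℕ → G n → ℝ) (C : ℝ) : Prop :=
  ∀ η > 0, ∀ᶠ q in FF, NN (x q.1 - x q.2) ≤ C + η

namespace Osc

variable {x y : ℕ → G n → ℝ} {C D : ℝ}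

lemma mono (h : Osc x C) (hCD : C ≤ D) : Osc x D := by
  intro η hη
  filter_upwards [h η hη] with q hq
  linarith

lemma zero : Osc (fun _ => (0 : G n → ℝ)) 0 := by
  intro η hη
  filter_upwards with q
  simp [NN_zero]; exact hη.le

lemma add (h : Osc x C) (h' : Osc y D) : Osc (fun m => x m + y m) (C + D) := by
  intro η hη
  filter_upwards [h (η / 2) (by linarith), h' (η / 2) (by linarith)] with q h1 h2
  have : x q.1 + y q.1 - (x q.2 + y q.2) = (x q.1 - x q.2) + (y q.1 - y q.2) := by abel
  rw [this]
  refine (NN_add _ _).trans ?_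
  linarith

lemma sum {ι : Type*} (s : Finset ι) {x : ι → ℕ → G n → ℝ} {C : ι → ℝ}
    (h : ∀ i ∈ s, Osc (x i) (C i)) : Osc (fun m => ∑ i ∈ s, x i m) (∑ i ∈ s, C i) := by
  classical
  induction s using Finset.induction_on with
  | empty => simpa using zero
  | insert a s ha ih =>
    simp_rw [sum_insert ha]
    exact (h a (mem_insert_self _ _)).add (ih fun i hi => h i (mem_insert_of_mem hi))

lemma smul {a : ℕ → ℝ} {a₀ M : ℝ} (ha : Tendsto a atTop (𝓝 a₀)) (ha0 : 0 ≤ a₀)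
    (hM' : ∀ᶠ m in atTop, NN (x m) ≤ M) (h : Osc x C) : Osc (fun m => a m • x m) (a₀ * C) := by
  intro η hη
  have hM0 : 0 ≤ M := by
    obtain ⟨m, hm⟩ := hM'.exists
    exact (NN_nonneg _).trans hm
  have hM1 : 0 < M + 1 := by linarith
  have e1 : ∀ᶠ m in atTop, |a m - a₀| < η / (3 * (M + 1)) := by
    have := Metric.tendsto_nhds.1 ha (η / (3 * (M + 1))) (by positivity)
    simpa [Real.dist_eq] using this
  filter_upwards [h (η / (3 * (a₀ + 1))) (by positivity), tendsto_fst.eventually e1,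
    tendsto_snd.eventually e1, tendsto_fst.eventually hM', tendsto_snd.eventually hM'] with
    q hq h1 h2 hM1' hM2'
  have : a q.1 • x q.1 - a q.2 • x q.2 = a₀ • (x q.1 - x q.2) + (a q.1 - a₀) • x q.1
      + -((a q.2 - a₀) • x q.2) := by module
  rw [this]
  refine (NN_add _ _).trans ((add_le_add_left (NN_add _ _) _).trans ?_)
  rw [NN_neg, NN_smul, NN_smul, NN_smul, abs_of_nonneg ha0]
  have b : ∀ t : ℝ, t < η / (3 * (M + 1)) → 0 ≤ t → ∀ m, NN (x m) ≤ M → t * NN (x m) ≤ η / 3 := by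
    intro t ht ht0 m hm
    calc t * NN (x m) ≤ η / (3 * (M + 1)) * (M + 1) := by
          refine mul_le_mul ht.le (hm.trans (by linarith)) (NN_nonneg _) (by positivity)
      _ = η / 3 := by field_simp
  have b1 := b _ h1 (abs_nonneg _) q.1 hM1'
  have b2 := b _ h2 (abs_nonneg _) q.2 hM2'
  have b3 : a₀ * NN (x q.1 - x q.2) ≤ a₀ * C + η / 3 := by
    calc a₀ * NN (x q.1 - x q.2) ≤ a₀ * (C + η / (3 * (a₀ + 1))) := by gcongr
      _ = a₀ * C + η / 3 * (a₀ / (a₀ + 1)) := by field_simp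
      _ ≤ a₀ * C + η / 3 * 1 := by
          gcongr
          rw [div_le_one (by positivity)]; linarith
      _ = _ := by ring
  linarith

lemma comp (h : Osc x C) {φ : ℕ → ℕ} (hφ : Tendsto φ atTop atTop) : Osc (fun m => x (φ m)) C := by
  intro η hη
  exact (hφ.prodMap hφ).eventually (h η hη)

lemma congr' (h : Osc x C) (hxy : ∀ᶠ m in atTop, x m = y m) : Osc y C := by
  intro η hη
  filter_upwards [h η hη, tendsto_fst.eventually hxy, tendsto_snd.eventually hxy] with q h1 h2 h3
  rw [← h2, ← h3]; exact h1

lemma of_succ (h : Osc (fun m => x (m + 1)) C) : Osc x C := by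
  refine (h.comp (tendsto_sub_atTop_nat 1)).congr' ?_
  filter_upwards [eventually_ge_atTop 1] with m hm
  rw [Nat.sub_add_cancel hm]

lemma lip {T : (G n → ℝ) → G n → ℝ} {k : ℝ} (hk : 0 ≤ k)
    (hT : ∀ a b, NN (T a - T b) ≤ k * NN (a - b)) (h : Osc x C) :
    Osc (fun m => T (x m)) (k * C) := by
  intro η hη
  filter_upwards [h (η / (k + 1)) (by positivity)] with q hq
  refine (hT _ _).trans ?_
  calc k * NN (x q.1 - x q.2) ≤ k * (C + η / (k + 1)) := by gcongr
    _ = k * C + η * (k / (k + 1)) := by field_simp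
    _ ≤ k * C + η * 1 := by
        gcongr
        rw [div_le_one (by positivity)]; linarith
    _ = _ := by ring

lemma mul_left (c : Bool) (z : G n → ℝ) (h : Osc x C) :
    Osc (fun m => mulc c z (x m)) (NN z * C) := by
  refine h.lip (T := fun a => mulc c z a) (NN_nonneg z) fun a b => ?_
  rw [← mulc_sub_right]
  exact NN_mulc _ _ _

lemma mul_right (c : Bool) (z : G n → ℝ) (h : Osc x C) :
    Osc (fun m => mulc c (x m) z) (NN z * C) := by
  refine h.lip (T := fun a => mulc c a z) (NN_nonneg z) fun a b => ?_
  rw [← mulc_sub_left, mul_comm]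
  exact NN_mulc _ _ _

lemma mul_right' (c : Bool) (z : G n → ℝ) (h : Osc x C) {t₀ : ℝ}
    (ht : Tendsto (fun m => tot (x m)) atTop (𝓝 t₀)) :
    Osc (fun m => mulc c (x m) z) ((NN z - |z (absf c)|) * C) := by
  intro η hη
  set k := NN z - |z (absf c)| with hkdef
  have hk : 0 ≤ k := sub_nonneg.2 (abs_le_NN z _)
  set s := |z (absf c)| with hs
  have hs0 : 0 ≤ s := abs_nonneg _
  have e1 : ∀ᶠ m in atTop, |tot (x m) - t₀| < η / (4 * (s + 1)) := by
    have := Metric.tendsto_nhds.1 ht (η / (4 * (s + 1))) (by positivity)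
    simpa [Real.dist_eq] using this
  filter_upwards [h (η / (2 * (k + 1))) (by positivity), tendsto_fst.eventually e1,
    tendsto_snd.eventually e1] with q hq h1 h2
  rw [← mulc_sub_left]
  refine (NN_mulc' _ _ _).trans ?_
  have et : tot (x q.1 - x q.2) = tot (x q.1) - tot (x q.2) := by
    unfold tot; simp [sum_sub_distrib]
  have b1 : |tot (x q.1 - x q.2)| ≤ η / (2 * (s + 1)) := by
    rw [et]
    have := abs_sub_le (tot (x q.1)) t₀ (tot (x q.2))
    rw [abs_sub_comm t₀] at this
    have e : η / (2 * (s + 1)) = η / (4 * (s + 1)) + η / (4 * (s + 1)) := by field_simp; ring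
    linarith
  have b2 : |tot (x q.1 - x q.2)| * s ≤ η / 2 := by
    calc |tot (x q.1 - x q.2)| * s ≤ η / (2 * (s + 1)) * (s + 1) := by
          refine mul_le_mul b1 (by linarith) hs0 (by positivity)
      _ = η / 2 := by field_simp
  have b3 : NN (x q.1 - x q.2) * k ≤ k * C + η / 2 := by
    calc NN (x q.1 - x q.2) * k ≤ (C + η / (2 * (k + 1))) * k := by gcongr
      _ = k * C + η / 2 * (k / (k + 1)) := by field_simp
      _ ≤ k * C + η / 2 * 1 := by
          gcongr
          rw [div_le_one (by positivity)]; linarith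
      _ = _ := by ring
  linarith

lemma tail {η : ℝ} (h : ∀ᶠ m in atTop, NN (x m) ≤ η) : Osc x (2 * η) := by
  intro ε hε
  filter_upwards [tendsto_fst.eventually h, tendsto_snd.eventually h] with q h1 h2
  refine (NN_sub _ _).trans ?_
  linarith

end Osc

end AndOr


namespace AndOr

open Filter Topology Finset
open AT

variable {n : ℕ}

/-- normalized vectors -/
noncomputable def uu (n : ℕ) (c : Bool) (m : ℕ) : G n → ℝ := (ll n m)⁻¹ • V n 2 c m
/-- normalized vectors -/
noncomputable def vv (n : ℕ) (c : Bool) (m : ℕ) : G n → ℝ := (ll n m)⁻¹ • V n 1 c m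

lemma bb_le_ll (m : ℕ) : bb n m ≤ ll n m := by
  rcases m with _ | m
  · rw [bb_zero, ll_zero]
  · rw [ll_succ]
    have := bb_nonneg (n := n) m
    have : (0 : ℝ) ≤ if m = 0 then 2 * (n : ℝ) else 0 := by split_ifs <;> positivity
    linarith

lemma NN_uu (c : Bool) (m : ℕ) : NN (uu n c m) ≤ 1 := by
  unfold uu
  rw [NN_smul, NN_V2, abs_of_nonneg (inv_nonneg.2 (ll_nonneg m)), inv_mul_eq_div]
  exact div_le_one_of_le₀ (bb_le_ll m) (ll_nonneg m)

lemma NN_vv (c : Bool) (m : ℕ) : NN (vv n c m) ≤ 1 := by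
  unfold vv
  rw [NN_smul, NN_V1, abs_of_nonneg (inv_nonneg.2 (ll_nonneg m)), inv_mul_eq_div]
  exact div_le_one_of_le₀ le_rfl (ll_nonneg m)

lemma tot_uu (hn : 1 ≤ n) (c : Bool) :
    Tendsto (fun m => tot (uu n c m)) atTop (𝓝 (1 + rho (2 * n))⁻¹) := by
  refine ((asyB hn).lim).congr fun m => ?_
  rw [PowerSeries.coeff_mk, ← tot_bb c m]
  unfold uu tot
  simp only [Pi.smul_apply, smul_eq_mul, ← mul_sum]
  rw [inv_mul_eq_div]

lemma V1_abs (hn : 1 ≤ n) (c : Bool) : 1 ≤ V n 1 c 2 (absf c) := by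
  unfold V cnt
  set ts : List (AT n) := [AT.leaf ⟨0, hn⟩ true, AT.leaf ⟨0, hn⟩ false] with hts
  have hmem : ts ∈ SF n 1 c 2 := by
    rw [mem_SF]
    refine ⟨?_, by simp [ts], ?_⟩
    · rw [hts, good_cons, good_cons]
      exact ⟨good_leaf (⟨0, hn⟩, true), good_leaf (⟨0, hn⟩, false), good_nil c⟩
    · rw [hts, sizeList_cons, sizeList_cons, sizeList_nil, size_leaf, size_leaf]
  have hev : evalList c ts = absf c := by
    rw [hts, evalList_cons, evalList_cons]
    funext x
    cases c <;> simp [op, absf, eval, evalList]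
  have := single_le_sum (s := SF n 1 c 2)
    (f := fun ts => if evalList c ts = absf c then (1 : ℝ) else 0)
    (fun _ _ => by split_ifs <;> norm_num) hmem
  simp only [hev, if_true] at this
  exact this

lemma osc_vv (hn : 1 ≤ n) {C : ℝ} (hC : ∀ c, Osc (uu n c) C) (c : Bool) :
    Osc (vv n c) ((1 + rho (2 * n)) * C) := by
  have h := mot hn
  have hρ := rho_pos h.hβ
  refine Osc.of_succ ?_
  have h1 := (hC c).comp (tendsto_add_atTop_nat 1)
  have h2 := (hC (!c)).smul h.ratio_one hρ.le (Eventually.of_forall fun m => NN_uu (!c) m)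
  refine ((h1.add h2).mono (le_of_eq (by ring))).congr' ?_
  filter_upwards [eventually_ge_atTop 1] with m hm
  have hp := (h.pos' (m := m) hm).ne'
  unfold uu vv
  rw [V1_eq, if_neg (by omega), add_zero, smul_smul, smul_add]
  congr 2
  field_simp

lemma osc_step (hn : 1 ≤ n) {C : ℝ} (hC0 : 0 ≤ C) (hC : ∀ c, Osc (uu n c) C) {η : ℝ} (hη : 0 < η)
    (c : Bool) : Osc (uu n c) ((1 - rho (2 * n) ^ 3) * C + η) := by
  have h := mot hn
  have hρ := rho_pos h.hβ
  set ρ := rho (2 * (n : ℝ)) with hρdef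
  obtain ⟨K₀, hK₀⟩ := h.tail (η := η / (2 * ρ)) (by positivity)
  set K := max K₀ 3 with hK
  have htail := hK₀ K (le_max_left _ _)
  have hK3 : 3 ≤ K := le_max_right _ _
  have hv := osc_vv hn hC
  have T0 := (hv c).mul_left c (lam n)
  have T1 : Osc (fun m => ∑ j ∈ range K, (ll n (m - j) / ll n m) •
      mulc c (V n 2 (!c) j) (vv n c (m - j))) (∑ j ∈ range K, ρ ^ j * (bb n j * ((1 + ρ) * C))) := by
    refine Osc.sum _ fun j _ => ?_
    have := ((hv c).comp (tendsto_sub_atTop_nat j)).mul_left c (V n 2 (!c) j)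
    rw [NN_V2] at this
    refine this.smul (M := bb n j) (h.ratio_sub j) (by positivity) (Eventually.of_forall fun m => ?_)
    refine (NN_mulc _ _ _).trans ?_
    rw [NN_V2]
    exact mul_le_of_le_one_right (bb_nonneg j) (NN_vv _ _)
  have T2 : Osc (fun m => ∑ i ∈ range K, (ll n (m - i) / ll n m) •
      mulc c (uu n (!c) (m - i)) (V n 1 c i))
      (∑ i ∈ range K, ρ ^ i * ((ll n i - |V n 1 c i (absf c)|) * C)) := by
    refine Osc.sum _ fun i _ => ?_
    have := ((hC (!c)).comp (tendsto_sub_atTop_nat i)).mul_right' c (V n 1 c i)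
      ((tot_uu hn (!c)).comp (tendsto_sub_atTop_nat i))
    rw [NN_V1] at this
    refine this.smul (M := ll n i) (h.ratio_sub i) (by positivity) (Eventually.of_forall fun m => ?_)
    refine (NN_mulc _ _ _).trans ?_
    rw [NN_V1]
    exact mul_le_of_le_one_left (ll_nonneg i) (NN_uu _ _)
  have T3 : Osc (fun m => (ll n m)⁻¹ • ∑ p ∈ (antidiagonal m).filter (fun p => K ≤ p.1 ∧ K ≤ p.2),
      mulc c (V n 2 (!c) p.1) (V n 1 c p.2)) (2 * (η / (2 * ρ))) := by
    refine Osc.tail ?_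
    filter_upwards [htail, eventually_ge_atTop 1] with m hm hm1
    have hp := h.pos' (m := m) hm1
    rw [NN_smul, abs_of_pos (inv_pos.2 hp), inv_mul_le_iff₀ hp, mul_comm]
    refine (NN_sum _ _).trans (le_trans (sum_le_sum fun p _ => ?_) hm)
    refine (NN_mulc _ _ _).trans ?_
    rw [NN_V1, NN_V2]
    exact mul_le_mul_of_nonneg_right (bb_le_ll _) (ll_nonneg _)
  have TT := ((T0.add T1).add T2).add T3
  rw [NN_lam] at TT
  have hid : ∀ᶠ m in atTop, mulc c (lam n) (vv n c m) + ∑ j ∈ range K, (ll n (m - j) / ll n m) •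
      mulc c (V n 2 (!c) j) (vv n c (m - j)) + ∑ i ∈ range K, (ll n (m - i) / ll n m) •
      mulc c (uu n (!c) (m - i)) (V n 1 c i) + (ll n m)⁻¹ • ∑ p ∈ (antidiagonal m).filter
        (fun p => K ≤ p.1 ∧ K ≤ p.2), mulc c (V n 2 (!c) p.1) (V n 1 c p.2)
      = (ll n m)⁻¹ • V n 2 c (m + 1) := by
    filter_upwards [eventually_ge_atTop (2 * K)] with m hm
    rw [V_rec 1 c m, antidiag_split _ K m hm, smul_add, smul_add, smul_add]
    have e0 : mulc c (lam n) (vv n c m) = (ll n m)⁻¹ • mulc c (lam n) (V n 1 c m) := by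
      unfold vv; rw [mulc_smul_right]
    rw [e0]
    simp only [smul_sum]
    have e1 : ∀ j ∈ range K, (ll n (m - j) / ll n m) • mulc c (V n 2 (!c) j) (vv n c (m - j))
        = (ll n m)⁻¹ • mulc c (V n 2 (!c) j) (V n 1 c (m - j)) := by
      intro j hj
      rw [mem_range] at hj
      have := (h.pos' (m := m - j) (by omega)).ne'
      unfold vv
      rw [mulc_smul_right, smul_smul]
      congr 1
      field_simp
    have e2 : ∀ j ∈ range K, (ll n (m - j) / ll n m) • mulc c (uu n (!c) (m - j)) (V n 1 c j)
        = (ll n m)⁻¹ • mulc c (V n 2 (!c) (m - j)) (V n 1 c j) := by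
      intro j hj
      rw [mem_range] at hj
      have := (h.pos' (m := m - j) (by omega)).ne'
      unfold uu
      rw [mulc_smul_left, smul_smul]
      congr 1
      field_simp
    rw [sum_congr rfl e1, sum_congr rfl e2]
    abel
  have TT2 := TT.congr' hid
  have TT3 : Osc (fun m => (ll n m / ll n (m + 1)) • (ll n m)⁻¹ • V n 2 c (m + 1))
      (ρ * (2 * n * ((1 + ρ) * C) + ∑ j ∈ range K, ρ ^ j * (bb n j * ((1 + ρ) * C))
          + ∑ i ∈ range K, ρ ^ i * ((ll n i - |V n 1 c i (absf c)|) * C) + 2 * (η / (2 * ρ)))) := by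
    refine TT2.smul (M := RR (2 * n) + 1) h.ratio_one hρ.le ?_
    filter_upwards [eventually_ge_atTop 1, h.ratio.eventually_le_const
      (lt_add_one (RR (2 * (n : ℝ))))] with m hm hm'
    rw [NN_smul, NN_V2, abs_of_nonneg (inv_nonneg.2 (ll_nonneg m)), inv_mul_eq_div]
    refine le_trans ?_ hm'
    exact div_le_div_of_nonneg_right (bb_le_ll _) (ll_nonneg m)
  refine Osc.of_succ ((TT3.mono ?_).congr' ?_)
  · have k1 : ∑ j ∈ range K, ρ ^ j * (bb n j * ((1 + ρ) * C))
        ≤ (√(2 * n) - 2 * n * ρ) * C := by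
      have : ∑ j ∈ range K, bb n j * ρ ^ j ≤ (√(2 * n) - 2 * n * ρ) / (1 + ρ) := by
        refine le_trans (le_of_eq (sum_congr rfl fun j _ => ?_)) (sum_le_hasSum (range K) (fun m _ => ?_) (asyB hn).sum)
        · rw [PowerSeries.coeff_mk]
        · exact mul_nonneg ((asyB hn).nonneg m) (by positivity)
      rw [le_div_iff₀ (by positivity)] at this
      calc ∑ j ∈ range K, ρ ^ j * (bb n j * ((1 + ρ) * C))
          = ((∑ j ∈ range K, bb n j * ρ ^ j) * (1 + ρ)) * C := by
            rw [sum_mul, sum_mul]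
            exact sum_congr rfl fun j _ => by ring
        _ ≤ _ := by gcongr
    have k2 : ∑ i ∈ range K, ρ ^ i * ((ll n i - |V n 1 c i (absf c)|) * C)
        ≤ (√(2 * n) - ρ ^ 2) * C := by
      have a1 := h.partial_le K
      have a2 : ρ ^ 2 ≤ ∑ i ∈ range K, ρ ^ i * |V n 1 c i (absf c)| := by
        have := single_le_sum (s := range K) (f := fun i => ρ ^ i * |V n 1 c i (absf c)|)
          (fun i _ => by positivity) (mem_range.2 (show 2 < K by omega))
        refine le_trans ?_ this
        have hh := (V1_abs hn c).trans (le_abs_self _)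
        exact le_mul_of_one_le_right (by positivity) hh
      calc ∑ i ∈ range K, ρ ^ i * ((ll n i - |V n 1 c i (absf c)|) * C)
          = (∑ i ∈ range K, ll n i * ρ ^ i - ∑ i ∈ range K, ρ ^ i * |V n 1 c i (absf c)|) * C := by
            rw [← sum_sub_distrib, sum_mul]
            exact sum_congr rfl fun j _ => by ring
        _ ≤ _ := by gcongr
    have k3 : ρ * (2 * n + 2 * √(2 * n)) = 1 := by
      have := RR_pos h.hβ
      rw [hρdef]; unfold rho
      rw [inv_mul_eq_one₀ this.ne']; rfl
    have k4 : ρ * (2 * (η / (2 * ρ))) = η := by field_simp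
    calc ρ * (2 * n * ((1 + ρ) * C) + ∑ j ∈ range K, ρ ^ j * (bb n j * ((1 + ρ) * C))
          + ∑ i ∈ range K, ρ ^ i * ((ll n i - |V n 1 c i (absf c)|) * C) + 2 * (η / (2 * ρ)))
        ≤ ρ * (2 * n * ((1 + ρ) * C) + (√(2 * n) - 2 * n * ρ) * C
          + (√(2 * n) - ρ ^ 2) * C + 2 * (η / (2 * ρ))) := by gcongr
      _ = (1 - ρ ^ 3) * C + η := by linear_combination C * k3 + k4
  · filter_upwards [eventually_ge_atTop 1] with m hm
    have hp := (h.pos' (m := m) hm).ne'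
    unfold uu
    rw [smul_smul]
    congr 1
    field_simp

lemma uu_cauchy (hn : 1 ≤ n) (c : Bool) : Osc (uu n c) 0 := by
  have h := mot hn
  have hρ := rho_pos h.hβ
  have hρ1 : rho (2 * (n : ℝ)) ^ 3 < 1 := by
    refine pow_lt_one₀ hρ.le ?_ (by norm_num)
    unfold rho
    apply inv_lt_one_of_one_lt₀
    unfold RR
    have := h.hβ
    have := Real.sqrt_nonneg (2 * (n : ℝ))
    linarith
  have key := contr (l := FF) (x := fun q => max (NN (uu n true q.1 - uu n true q.2))
    (NN (uu n false q.1 - uu n false q.2))) (q := 1 - rho (2 * (n : ℝ)) ^ 3) (C₀ := 2)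
    (by linarith) (by have := pow_pos hρ 3; linarith) ?_ (by norm_num) ?_
  · intro η hη
    filter_upwards [key η hη] with q hq
    rw [zero_add]
    cases c
    · exact (le_max_right _ _).trans hq
    · exact (le_max_left _ _).trans hq
  · filter_upwards with q
    refine max_le ?_ ?_ <;> refine (NN_sub _ _).trans ?_
    · have := NN_uu (n := n) true q.1; have := NN_uu (n := n) true q.2; linarith
    · have := NN_uu (n := n) false q.1; have := NN_uu (n := n) false q.2; linarith
  · intro C hC0 hC η hη
    have hO : ∀ c, Osc (uu n c) C := by
      intro c ε hε
      filter_upwards [hC] with q hq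
      cases c
      · exact ((le_max_right _ _).trans hq).trans (by linarith)
      · exact ((le_max_left _ _).trans hq).trans (by linarith)
    have s := fun c => osc_step hn hC0 hO (half_pos hη) c (η / 2) (half_pos hη)
    filter_upwards [s true, s false] with q h1 h2
    refine max_le (by linarith) (by linarith)

lemma uu_lim (hn : 1 ≤ n) (c : Bool) (g : G n) : ∃ a, Tendsto (fun m => uu n c m g) atTop (𝓝 a) := by
  refine cauchy_map_iff_exists_tendsto.1 ?_
  rw [cauchy_map_iff]
  refine ⟨inferInstance, ?_⟩
  rw [Metric.uniformity_basis_dist.tendsto_right_iff]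
  intro ε hε
  filter_upwards [uu_cauchy hn c (ε / 2) (half_pos hε)] with q hq
  have := abs_le_NN (uu n c q.1 - uu n c q.2) g
  simp only [Real.dist_eq]
  rw [Pi.sub_apply] at this
  linarith

/-- existence of limiting probabilities -/
lemma P_exists (n : ℕ) (g : G n) : ∃ a, Tendsto (fun m => Pmn n m g) atTop (𝓝 a) := by
  rcases Nat.eq_zero_or_pos n with rfl | hn
  · refine ⟨0, tendsto_const_nhds.congr' ?_⟩
    have hA : ∀ m, ll 0 m = 0 ∧ bb 0 m = 0 := by
      intro m
      induction m using Nat.strong_induction_on with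
      | _ m ih =>
        rcases m with _ | m
        · exact ⟨ll_zero, bb_zero⟩
        · have hb : bb 0 (m + 1) = 0 := by
            rw [bb_succ]
            simp only [CharP.cast_eq_zero, mul_zero, zero_mul, zero_add]
            refine sum_eq_zero fun p hp => ?_
            rw [HasAntidiagonal.mem_antidiagonal] at hp
            rw [(ih p.1 (by omega)).2, zero_mul]
          refine ⟨?_, hb⟩
          rw [ll_succ, hb, (ih m (by omega)).2]; simp
    filter_upwards [eventually_ge_atTop 2] with m hm
    obtain ⟨k, rfl⟩ : ∃ k, m = k + 1 := ⟨m - 1, by omega⟩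
    unfold Pmn
    rw [A_eq k (by omega), (hA k).2]; simp
  · obtain ⟨a, ha⟩ := uu_lim hn true g
    obtain ⟨b, hb⟩ := uu_lim hn false g
    have h := mot hn
    have hρ := rho_pos h.hβ
    have hB := (asyB hn).lim
    have := (ha.add hb).div (hB.const_mul 2) (by positivity)
    refine ⟨_, (tendsto_add_atTop_iff_nat 1).1 (this.congr' ?_)⟩
    filter_upwards [eventually_ge_atTop 1] with m hm
    have hp := (h.pos' (m := m) hm).ne'
    unfold Pmn
    rw [count_eval m hm, A_eq m hm, Pi.div_apply, PowerSeries.coeff_mk]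
    unfold uu
    simp only [Pi.smul_apply, smul_eq_mul]
    rw [← mul_add, ← mul_div_assoc, inv_mul_eq_div, div_div_div_cancel_right₀ hp]

end AndOr


namespace AndOr

open Filter Topology Finset
open AT

/-- `S` has at most `coeff m P` elements of size `m` -/
def Dom {α : Type*} (S : Set α) (sz : α → ℕ) (P : PowerSeries ℝ) : Prop :=
  ∀ m, ∃ F : Finset α, (∀ a ∈ S, sz a = m → a ∈ F) ∧ (F.card : ℝ) ≤ PowerSeries.coeff m P

namespace Dom

variable {α γ : Type*} {S S' : Set α} {T : Set γ} {sz : α → ℕ} {sz' : γ → ℕ} {P Q : PowerSeries ℝ}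

lemma mono (h : Dom S sz P) (hs : S' ⊆ S) : Dom S' sz P := by
  intro m
  obtain ⟨F, h1, h2⟩ := h m
  exact ⟨F, fun a ha => h1 a (hs ha), h2⟩

lemma union (h : Dom S sz P) (h' : Dom S' sz Q) : Dom (S ∪ S') sz (P + Q) := by
  classical
  intro m
  obtain ⟨F, h1, h2⟩ := h m
  obtain ⟨F', h1', h2'⟩ := h' m
  refine ⟨F ∪ F', ?_, ?_⟩
  · rintro a (ha | ha) hm
    · exact mem_union_left _ (h1 a ha hm)
    · exact mem_union_right _ (h1' a ha hm)
  · rw [map_add]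
    have : ((F ∪ F').card : ℝ) ≤ F.card + F'.card := by exact_mod_cast card_union_le F F'
    linarith

lemma prod (h : Dom S sz P) (h' : Dom T sz' Q) :
    Dom (S ×ˢ T) (fun p => sz p.1 + sz' p.2) (P * Q) := by
  classical
  choose F h1 h2 using h
  choose F' h1' h2' using h'
  intro m
  refine ⟨(antidiagonal m).biUnion (fun p => F p.1 ×ˢ F' p.2), ?_, ?_⟩
  · rintro ⟨a, b⟩ ⟨ha, hb⟩ hm
    rw [mem_biUnion]
    refine ⟨(sz a, sz' b), ?_, ?_⟩
    · rw [HasAntidiagonal.mem_antidiagonal]; exact hm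
    · rw [mem_product]; exact ⟨h1 _ a ha rfl, h1' _ b hb rfl⟩
  · rw [PowerSeries.coeff_mul]
    have : (((antidiagonal m).biUnion (fun p => F p.1 ×ˢ F' p.2)).card : ℝ)
        ≤ ∑ p ∈ antidiagonal m, ((F p.1 ×ˢ F' p.2).card : ℝ) := by
      exact_mod_cast card_biUnion_le
    refine this.trans (sum_le_sum fun p _ => ?_)
    rw [card_product]
    push_cast
    exact mul_le_mul (h2 _) (h2' _) (by positivity) ((Nat.cast_nonneg _).trans (h2 _))

lemma image (h : Dom S sz P) (f : α → γ) (s : ℕ) (hf : ∀ a, sz' (f a) = sz a + s)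
    (hT : ∀ t ∈ T, ∃ a ∈ S, f a = t) : Dom T sz' (PowerSeries.X ^ s * P) := by
  classical
  intro m
  rw [PowerSeries.coeff_X_pow_mul']
  split_ifs with hs
  · obtain ⟨F, h1, h2⟩ := h (m - s)
    refine ⟨F.image f, ?_, ?_⟩
    · intro t ht hm
      obtain ⟨a, ha, rfl⟩ := hT t ht
      rw [hf] at hm
      exact mem_image_of_mem _ (h1 a ha (by omega))
    · have : ((F.image f).card : ℝ) ≤ F.card := by exact_mod_cast card_image_le
      linarith
  · refine ⟨∅, ?_, by simp⟩
    intro t ht hm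
    obtain ⟨a, ha, rfl⟩ := hT t ht
    rw [hf] at hm
    omega

lemma label (ι : Type*) [Fintype ι] :
    Dom (Set.univ : Set ι) (fun _ => 0) (PowerSeries.C (Fintype.card ι : ℝ)) := by
  intro m
  rw [PowerSeries.coeff_C]
  rcases m with _ | m
  · exact ⟨univ, by simp, by simp⟩
  · exact ⟨∅, by simp, by simp⟩

end Dom

variable {n : ℕ}

/-- generating function of possibly empty valid lists -/
noncomputable def QQ (n : ℕ) : PowerSeries ℝ := 1 + PowerSeries.mk (ll n)

lemma dom_list (c : Bool) : Dom {ts : List (AT n) | Good c ts} sizeList (QQ n) := by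
  intro m
  refine ⟨SF n 0 c m, fun ts h1 h2 => mem_SF.2 ⟨h1, by omega, h2⟩, ?_⟩
  unfold QQ
  rw [map_add, PowerSeries.coeff_mk, PowerSeries.coeff_one]
  rcases m with _ | m
  · rw [SF_zero]; simp [ll_nonneg]
  · rw [SF_succ, card_ll]; simp

lemma evalList_or {ts : List (AT n)} {x : Fin n → Bool} :
    evalList false ts x = true ↔ ∃ t ∈ ts, eval t x = true := by
  induction ts with
  | nil => simp [evalList]
  | cons t ts ih => rw [evalList]; simp [ih]

lemma evalList_and {ts : List (AT n)} {x : Fin n → Bool} :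
    evalList true ts x = true ↔ ∀ t ∈ ts, eval t x = true := by
  induction ts with
  | nil => simp [evalList]
  | cons t ts ih => rw [evalList]; simp [ih]

lemma split_two {α : Type*} {ts : List α} {t t' : α} (h : t ∈ ts) (h' : t' ∈ ts) (hne : t ≠ t') :
    ∃ xs ys zs, ts = xs ++ t :: (ys ++ t' :: zs) ∨ ts = xs ++ t' :: (ys ++ t :: zs) := by
  obtain ⟨as, bs, rfl⟩ := List.append_of_mem h
  rw [List.mem_append, List.mem_cons] at h'
  rcases h' with h' | h' | h'
  · obtain ⟨cs, ds, rfl⟩ := List.append_of_mem h'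
    exact ⟨cs, ds, bs, Or.inr (by simp)⟩
  · exact absurd h'.symm hne
  · obtain ⟨cs, ds, rfl⟩ := List.append_of_mem h'
    exact ⟨as, cs, ds, Or.inl rfl⟩

/-- leaf with a literal pair -/
abbrev lf (p : Fin n × Bool) : AT n := AT.leaf p.1 p.2

/-- node-trees that are true whenever the first `n₀` variables are `y₀`, but not tautologies -/
def Bad {n₀ : ℕ} (h : n₀ ≤ n) (y₀ : Fin n₀ → Bool) : Set (AT n) :=
  {t | (∀ x : Fin n → Bool, (∀ j, x (Fin.castLE h j) = y₀ j) → eval t x = true) ∧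
    (eval t ≠ fun _ => true) ∧ WF t ∧ ∃ c ts, t = AT.node c ts}

/-- lists -/
abbrev LT (n : ℕ) := List (AT n)

/-- negated literal -/
def ng (p : Fin n × Bool) : Fin n × Bool := (p.1, !p.2)

/-- low literal -/
def lo {n₀ : ℕ} (h : n₀ ≤ n) (p : Fin n₀ × Bool) : Fin n × Bool := (Fin.castLE h p.1, p.2)

/-- family 1 -/
def E1 (n : ℕ) : Set (AT n) := {t | ∃ vs us : LT n, Good false vs ∧ Good true us ∧
  t = AT.node true (AT.node false vs :: us)}
/-- family 1' -/
def E1' {n₀ : ℕ} (h : n₀ ≤ n) : Set (AT n) := {t | ∃ p, ∃ us : LT n, Good true us ∧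
  t = AT.node true (lf (lo h p) :: us)}
/-- family 2 -/
def E2 {n₀ : ℕ} (h : n₀ ≤ n) : Set (AT n) := {t | ∃ p, ∃ xs ys : LT n, Good false xs ∧
  Good false ys ∧ t = AT.node false (xs ++ lf (lo h p) :: ys)}
/-- family 3 -/
def E3 (n : ℕ) : Set (AT n) := {t | ∃ xs ys vs us : LT n, Good false xs ∧
  Good false ys ∧ Good false vs ∧ Good true us ∧
  t = AT.node false (xs ++ AT.node true (AT.node false vs :: us) :: ys)}
/-- family 4 -/
def E4 (n : ℕ) : Set (AT n) := {t | ∃ p, ∃ xs ys zs us : LT n, Good false xs ∧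
  Good false ys ∧ Good false zs ∧ Good true us ∧
  t = AT.node false (xs ++ lf p :: (ys ++ AT.node true (lf (ng p) :: us) :: zs))}
/-- family 4' -/
def E4' (n : ℕ) : Set (AT n) := {t | ∃ p, ∃ xs ys zs us : LT n, Good false xs ∧
  Good false ys ∧ Good false zs ∧ Good true us ∧
  t = AT.node false (xs ++ AT.node true (lf (ng p) :: us) :: (ys ++ lf p :: zs))}
/-- family 5 -/
def E5 {n₀ : ℕ} (h : n₀ ≤ n) : Set (AT n) := {t | ∃ p, ∃ xs ys us : LT n, Good false xs ∧
  Good false ys ∧ Good true us ∧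
  t = AT.node false (xs ++ AT.node true (lf (lo h p) :: us) :: ys)}
/-- family 6 -/
def E6 (n : ℕ) : Set (AT n) := {t | ∃ p, ∃ xs ys zs us us' : LT n, Good false xs ∧
  Good false ys ∧ Good false zs ∧ Good true us ∧ Good true us' ∧
  t = AT.node false (xs ++ AT.node true (lf p :: us) :: (ys ++ AT.node true (lf (ng p) :: us') :: zs))}

/-- representative literal -/
def Rep (t : AT n) (p : Fin n × Bool) : Prop := t = lf p ∨ ∃ us, Good true us ∧ t = AT.node true (lf p :: us)

lemma lf_inj {p q : Fin n × Bool} (h : lf p = lf q) : p = q := by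
  simp only [AT.leaf.injEq] at h
  exact Prod.ext h.1 h.2

lemma rep_unique {t : AT n} {p q : Fin n × Bool} (h : Rep t p) (h' : Rep t q) : p = q := by
  rcases h with rfl | ⟨us, _, rfl⟩ <;> rcases h' with h' | ⟨us', _, h'⟩
  · exact lf_inj h'
  · simp at h'
  · simp at h'
  · simp only [AT.node.injEq, List.cons.injEq, true_and] at h'
    exact lf_inj h'.1

lemma rep_false {t : AT n} {p : Fin n × Bool} (h : Rep t p) {x : Fin n → Bool}
    (hx : eval (lf p) x = false) : eval t x = false := by
  rcases h with rfl | ⟨us, _, rfl⟩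
  · exact hx
  · rw [eval_node, evalList_cons]; simp only [op, if_true]; rw [hx]; rfl

lemma ng_ng (p : Fin n × Bool) : ng (ng p) = p := by simp [ng]

lemma ng_eval {p : Fin n × Bool} {x : Fin n → Bool} (hx : ¬ eval (lf p) x = true) :
    eval (lf (ng p)) x = true := by
  obtain ⟨i, b⟩ := p
  cases b <;> simpa [eval, ng, lf] using hx

lemma bad_and {n₀ : ℕ} (h : n₀ ≤ n) (y₀ : Fin n₀ → Bool) {ts : LT n}
    (ht : AT.node true ts ∈ Bad h y₀) : AT.node true ts ∈ E1 n ∪ E1' h := by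
  classical
  obtain ⟨h1, h2, h3, _⟩ := ht
  rw [wf_node_iff] at h3
  cases ts with
  | nil => simp at h3
  | cons t us =>
    have hg := good_cons.1 h3.2
    rcases head_cases hg.1 with ⟨p, rfl⟩ | ⟨vs, rfl, _, hvs⟩
    · right
      by_cases hp : p.1.1 < n₀
      · exact ⟨(⟨p.1.1, hp⟩, p.2), us, hg.2, rfl⟩
      · exfalso
        have := h1 (fun i => if hi : i.1 < n₀ then y₀ ⟨i.1, hi⟩ else !p.2) (by intro j; simp)
        rw [eval_node, evalList_and] at this
        have := this _ (List.mem_cons_self)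
        rw [eval] at this
        simp only [hp, dite_false] at this
        cases hb : p.2 <;> simp [hb] at this
    · left
      exact ⟨vs, us, hvs, hg.2, rfl⟩

lemma bad_or {n₀ : ℕ} (h : n₀ ≤ n) (y₀ : Fin n₀ → Bool) {ts : LT n}
    (ht : AT.node false ts ∈ Bad h y₀) :
    AT.node false ts ∈ E2 h ∪ (E3 n ∪ (E4 n ∪ (E4' n ∪ (E5 h ∪ E6 n)))) := by
  classical
  obtain ⟨h1, h2, h3, _⟩ := ht
  rw [wf_node_iff] at h3
  obtain ⟨hlen, hg⟩ := h3
  by_contra hcon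
  simp only [Set.mem_union, not_or] at hcon
  obtain ⟨n2, n3, n4, n4', n5, n6⟩ := hcon
  have hsplit : ∀ {xs ys : LT n} {t : AT n}, ts = xs ++ t :: ys → Good false xs ∧ Good false ys ∧
      WF t ∧ rootConn t ≠ some false := by
    intro xs ys t e
    rw [e, good_append, good_cons] at hg
    exact ⟨hg.1, hg.2.2, hg.2.1⟩
  have hrep : ∀ t ∈ ts, ∃ p, Rep t p := by
    intro t htm
    rcases head_cases (hg t htm) with ⟨p, rfl⟩ | ⟨us, rfl, hus1, hus2⟩
    · exact ⟨p, Or.inl rfl⟩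
    · cases us with
      | nil => simp at hus1
      | cons u us =>
        rw [good_cons] at hus2
        rcases head_cases hus2.1 with ⟨p, rfl⟩ | ⟨vs, rfl, _, hvs⟩
        · exact ⟨p, Or.inr ⟨us, hus2.2, rfl⟩⟩
        · exfalso
          obtain ⟨xs, ys, e⟩ := List.append_of_mem htm
          obtain ⟨g1, g2, _⟩ := hsplit e
          exact n3 ⟨xs, ys, vs, us, g1, g2, hvs, hus2.2, by rw [e]; rfl⟩
  have hhigh : ∀ t ∈ ts, ∀ p, Rep t p → ¬ p.1.1 < n₀ := by
    intro t htm p hp hlt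
    obtain ⟨xs, ys, e⟩ := List.append_of_mem htm
    obtain ⟨g1, g2, _⟩ := hsplit e
    rcases hp with rfl | ⟨us, hus, rfl⟩
    · exact n2 ⟨(⟨p.1.1, hlt⟩, p.2), xs, ys, g1, g2, by rw [e]; rfl⟩
    · exact n5 ⟨(⟨p.1.1, hlt⟩, p.2), xs, ys, us, g1, g2, hus, by rw [e]; rfl⟩
  have hcomp : ∀ t ∈ ts, ∀ t' ∈ ts, ∀ p, Rep t p → ¬ Rep t' (ng p) := by
    intro t htm t' htm' p hp hp'
    have hnp : p ≠ ng p := by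
      intro e
      have := congrArg Prod.snd e
      simp [ng] at this
    have hne : t ≠ t' := by
      rintro rfl
      exact hnp (rep_unique hp hp')
    have hgs : ∀ {xs ys zs : LT n} {a b : AT n}, ts = xs ++ a :: (ys ++ b :: zs) →
        Good false xs ∧ Good false ys ∧ Good false zs := by
      intro xs ys zs a b e
      rw [e, good_append, good_cons, good_append, good_cons] at hg
      exact ⟨hg.1, hg.2.2.1, hg.2.2.2.2⟩
    obtain ⟨xs, ys, zs, e⟩ := split_two htm htm' hne
    have hgood : Good false xs ∧ Good false ys ∧ Good false zs := by
      rcases e with e | e <;> exact hgs e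
    obtain ⟨gx, gy, gz⟩ := hgood
    rcases hp with rfl | ⟨us, hus, rfl⟩ <;> rcases hp' with rfl | ⟨us', hus', rfl⟩
    · apply h2
      funext x
      rw [eval_node, evalList_or]
      by_cases hx : eval (lf p) x = true
      · exact ⟨_, htm, hx⟩
      · refine ⟨_, htm', ?_⟩
        exact ng_eval hx
    · rcases e with e | e
      · exact n4 ⟨p, xs, ys, zs, us', gx, gy, gz, hus', by rw [e]⟩
      · exact n4' ⟨p, xs, ys, zs, us', gx, gy, gz, hus', by rw [e]⟩
    · rcases e with e | e
      · exact n4' ⟨ng p, xs, ys, zs, us, gx, gy, gz, hus, by rw [e, ng_ng]⟩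
      · exact n4 ⟨ng p, xs, ys, zs, us, gx, gy, gz, hus, by rw [e, ng_ng]⟩
    · rcases e with e | e
      · exact n6 ⟨p, xs, ys, zs, us, us', gx, gy, gz, hus, hus', by rw [e]⟩
      · exact n6 ⟨ng p, xs, ys, zs, us', us, gx, gy, gz, hus', hus, by rw [e, ng_ng]⟩
  have key := h1 (fun i => if hi : i.1 < n₀ then y₀ ⟨i.1, hi⟩ else
    if ∃ t ∈ ts, Rep t (i, true) then false else true) (by intro j; simp)
  rw [eval_node, evalList_or] at key
  obtain ⟨t, htm, hev⟩ := key
  obtain ⟨p, hp⟩ := hrep t htm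
  have hlow := hhigh t htm p hp
  rw [rep_false hp] at hev
  · simp at hev
  · rw [eval]
    simp only [hlow, dite_false]
    obtain ⟨i, b⟩ := p
    cases b
    · have : ¬ ∃ t ∈ ts, Rep t (i, true) := by
        rintro ⟨t', ht', hr⟩
        exact hcomp t htm t' ht' _ hp hr
      simp [this]
    · have : ∃ t ∈ ts, Rep t (i, true) := ⟨t, htm, hp⟩
      simp [this]

lemma bad_sub {n₀ : ℕ} (h : n₀ ≤ n) (y₀ : Fin n₀ → Bool) :
    Bad h y₀ ⊆ (E1 n ∪ E1' h) ∪ (E2 h ∪ (E3 n ∪ (E4 n ∪ (E4' n ∪ (E5 h ∪ E6 n))))) := by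
  intro t ht
  obtain ⟨c, ts, rfl⟩ := ht.2.2.2
  cases c
  · exact Or.inr (bad_or h y₀ ht)
  · exact Or.inl (bad_and h y₀ ht)

end AndOr


namespace AndOr

open Filter Topology Finset
open AT

variable {n : ℕ}

open PowerSeries in
lemma dom_E1 : Dom (E1 n) size (X ^ 2 * (QQ n * QQ n)) := by
  refine ((dom_list false).prod (dom_list true)).image
    (fun z => AT.node true (AT.node false z.1 :: z.2)) 2 ?_ ?_
  · intro z; simp only [size_node, sizeList_cons]; omega
  · rintro t ⟨vs, us, h1, h2, rfl⟩
    exact ⟨(vs, us), ⟨h1, h2⟩, rfl⟩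

open PowerSeries in
lemma dom_E1' {n₀ : ℕ} (h : n₀ ≤ n) :
    Dom (E1' h) size (X ^ 2 * (C (Fintype.card (Fin n₀ × Bool) : ℝ) * QQ n)) := by
  refine ((Dom.label _).prod (dom_list true)).image
    (fun z => AT.node true (lf (lo h z.1) :: z.2)) 2 ?_ ?_
  · intro z; simp only [size_node, sizeList_cons, size_leaf]; omega
  · rintro t ⟨p, us, h1, rfl⟩
    exact ⟨(p, us), ⟨trivial, h1⟩, rfl⟩

open PowerSeries in
lemma dom_E2 {n₀ : ℕ} (h : n₀ ≤ n) :
    Dom (E2 h) size (X ^ 2 * (C (Fintype.card (Fin n₀ × Bool) : ℝ) * (QQ n * QQ n))) := by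
  refine ((Dom.label _).prod ((dom_list false).prod (dom_list false))).image
    (fun z => AT.node false (z.2.1 ++ lf (lo h z.1) :: z.2.2)) 2 ?_ ?_
  · intro z; simp only [size_node, sizeList_cons, size_leaf, sizeList_append]; omega
  · rintro t ⟨p, xs, ys, h1, h2, rfl⟩
    exact ⟨(p, xs, ys), ⟨trivial, h1, h2⟩, rfl⟩

open PowerSeries in
lemma dom_E3 : Dom (E3 n) size (X ^ 3 * (QQ n * (QQ n * (QQ n * QQ n)))) := by
  refine ((dom_list false).prod ((dom_list false).prod ((dom_list false).prod (dom_list true)))).image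
    (fun z => AT.node false (z.1 ++ AT.node true (AT.node false z.2.2.1 :: z.2.2.2) :: z.2.1)) 3 ?_ ?_
  · intro z; simp only [size_node, sizeList_cons, sizeList_append]; omega
  · rintro t ⟨xs, ys, vs, us, h1, h2, h3, h4, rfl⟩
    exact ⟨(xs, ys, vs, us), ⟨h1, h2, h3, h4⟩, rfl⟩

open PowerSeries in
lemma dom_E4 : Dom (E4 n) size (X ^ 4 * (C (Fintype.card (Fin n × Bool) : ℝ) *
    (QQ n * (QQ n * (QQ n * QQ n))))) := by
  refine ((Dom.label _).prod ((dom_list false).prod ((dom_list false).prod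
    ((dom_list false).prod (dom_list true))))).image
    (fun z => AT.node false (z.2.1 ++ lf z.1 :: (z.2.2.1 ++
      AT.node true (lf (ng z.1) :: z.2.2.2.2) :: z.2.2.2.1))) 4 ?_ ?_
  · intro z; simp only [size_node, sizeList_cons, sizeList_append, size_leaf]; omega
  · rintro t ⟨p, xs, ys, zs, us, h1, h2, h3, h4, rfl⟩
    exact ⟨(p, xs, ys, zs, us), ⟨trivial, h1, h2, h3, h4⟩, rfl⟩

open PowerSeries in
lemma dom_E4' : Dom (E4' n) size (X ^ 4 * (C (Fintype.card (Fin n × Bool) : ℝ) *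
    (QQ n * (QQ n * (QQ n * QQ n))))) := by
  refine ((Dom.label _).prod ((dom_list false).prod ((dom_list false).prod
    ((dom_list false).prod (dom_list true))))).image
    (fun z => AT.node false (z.2.1 ++ AT.node true (lf (ng z.1) :: z.2.2.2.2) :: (z.2.2.1 ++
      lf z.1 :: z.2.2.2.1))) 4 ?_ ?_
  · intro z; simp only [size_node, sizeList_cons, sizeList_append, size_leaf]; omega
  · rintro t ⟨p, xs, ys, zs, us, h1, h2, h3, h4, rfl⟩
    exact ⟨(p, xs, ys, zs, us), ⟨trivial, h1, h2, h3, h4⟩, rfl⟩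

open PowerSeries in
lemma dom_E5 {n₀ : ℕ} (h : n₀ ≤ n) : Dom (E5 h) size (X ^ 3 *
    (C (Fintype.card (Fin n₀ × Bool) : ℝ) * (QQ n * (QQ n * QQ n)))) := by
  refine ((Dom.label _).prod ((dom_list false).prod ((dom_list false).prod (dom_list true)))).image
    (fun z => AT.node false (z.2.1 ++ AT.node true (lf (lo h z.1) :: z.2.2.2) :: z.2.2.1)) 3 ?_ ?_
  · intro z; simp only [size_node, sizeList_cons, sizeList_append, size_leaf]; omega
  · rintro t ⟨p, xs, ys, us, h1, h2, h3, rfl⟩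
    exact ⟨(p, xs, ys, us), ⟨trivial, h1, h2, h3⟩, rfl⟩

open PowerSeries in
lemma dom_E6 : Dom (E6 n) size (X ^ 5 * (C (Fintype.card (Fin n × Bool) : ℝ) *
    (QQ n * (QQ n * (QQ n * (QQ n * QQ n)))))) := by
  refine ((Dom.label _).prod ((dom_list false).prod ((dom_list false).prod
    ((dom_list false).prod ((dom_list true).prod (dom_list true)))))).image
    (fun z => AT.node false (z.2.1 ++ AT.node true (lf z.1 :: z.2.2.2.2.1) :: (z.2.2.1 ++
      AT.node true (lf (ng z.1) :: z.2.2.2.2.2) :: z.2.2.2.1))) 5 ?_ ?_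
  · intro z; simp only [size_node, sizeList_cons, sizeList_append, size_leaf]; omega
  · rintro t ⟨p, xs, ys, zs, us, us', h1, h2, h3, h4, h5, rfl⟩
    exact ⟨(p, xs, ys, zs, us, us'), ⟨trivial, h1, h2, h3, h4, h5⟩, rfl⟩

lemma asyQ (hn : 1 ≤ n) : Asy (2 * (n : ℝ)) (ll n) (QQ n) 1 (1 + √(2 * n)) := by
  have := Asy.one.add (Asy.base (mot hn))
  rwa [zero_add] at this

/-- the constant bounding the proportion of bad trees -/
noncomputable def kap (n₀ n : ℕ) : ℝ :=
  (4 + 14 * n₀ + 30) / √(2 * n)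

/-- Bound on bad trees -/
lemma bad_dom {n₀ : ℕ} (h : n₀ ≤ n) (y₀ : Fin n₀ → Bool) (hn : 1 ≤ n) :
    ∃ P a S, Dom (Bad h y₀) size P ∧ Asy (2 * (n : ℝ)) (ll n) P a S ∧ a ≤ rho (2 * n) * kap n₀ n := by
  have hM := mot hn
  have hQ := asyQ hn
  have c0 : (0 : ℝ) ≤ (Fintype.card (Fin n₀ × Bool) : ℝ) := by positivity
  have c1 : (0 : ℝ) ≤ (Fintype.card (Fin n × Bool) : ℝ) := by positivity
  have a2 := hQ.mul hM hQ
  have a3 := hQ.mul hM a2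
  have a4 := hQ.mul hM a3
  have a5 := hQ.mul hM a4
  refine ⟨_, _, _, Dom.mono ((dom_E1.union (dom_E1' h)).union ((dom_E2 h).union (dom_E3.union
    (dom_E4.union (dom_E4'.union ((dom_E5 h).union dom_E6)))))) (bad_sub h y₀),
    ((a2.X_pow_mul hM 2).add ((hQ.smul _ c0).X_pow_mul hM 2)).add
      (((a2.smul _ c0).X_pow_mul hM 2).add ((a4.X_pow_mul hM 3).add
      (((a4.smul _ c1).X_pow_mul hM 4).add (((a4.smul _ c1).X_pow_mul hM 4).add
      (((a3.smul _ c0).X_pow_mul hM 3).add ((a5.smul _ c1).X_pow_mul hM 5)))))), ?_⟩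
  have e0 : (Fintype.card (Fin n₀ × Bool) : ℝ) = 2 * n₀ := by simp; ring
  have e1 : (Fintype.card (Fin n × Bool) : ℝ) = √(2 * n) ^ 2 := by
    rw [Real.sq_sqrt (by positivity)]; simp; ring
  rw [e0, e1]
  have hρ := rho_pos hM.hβ
  have hw : 1 ≤ √(2 * (n : ℝ)) := by
    rw [Real.one_le_sqrt]; have := hM.hβ; linarith
  have hρw : rho (2 * (n : ℝ)) * (√(2 * n) * (√(2 * n) + 2)) = 1 := by
    unfold rho
    rw [inv_mul_eq_one₀ (RR_pos hM.hβ).ne']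
    unfold RR
    have := Real.mul_self_sqrt (show (0 : ℝ) ≤ 2 * n by positivity)
    linarith
  unfold kap
  generalize rho (2 * (n : ℝ)) = ρ at *
  generalize √(2 * (n : ℝ)) = w at *
  have hw0 : 0 < w := by linarith
  set i := 1 / w with hi
  have hi0 : 0 < i := by positivity
  have hi1 : i ≤ 1 := by rw [hi, div_le_one hw0]; exact hw
  have hiw : i * w = 1 := by rw [hi]; field_simp
  have z1 : ρ * (1 + w) ≤ i := by
    rw [hi, le_div_iff₀ hw0]; nlinarith
  have z2 : ρ ≤ i ^ 2 := by
    have : ρ * w ^ 2 ≤ 1 := by nlinarith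
    calc ρ = ρ * w ^ 2 * i ^ 2 := by linear_combination (-ρ) * (i * w + 1) * hiw
      _ ≤ 1 * i ^ 2 := by gcongr
      _ = i ^ 2 := one_mul _
  set z := ρ * (1 + w) with hz
  have hz0 : 0 < z := by positivity
  have hN : (0 : ℝ) ≤ n₀ := by positivity
  have t1 : z ^ 2 * (1 + w) ≤ 2 * i := by
    calc z ^ 2 * (1 + w) ≤ i ^ 2 * (1 + w) := by gcongr
      _ = i ^ 2 + i := by linear_combination i * hiw
      _ ≤ 2 * i := by nlinarith
  have t2 : w ^ 2 * z ^ 3 ≤ i := by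
    calc w ^ 2 * z ^ 3 ≤ w ^ 2 * i ^ 3 := by gcongr
      _ = i := by linear_combination i * (i * w + 1) * hiw
  have t3 : w ^ 2 * z ^ 4 ≤ i := by
    calc w ^ 2 * z ^ 4 ≤ w ^ 2 * i ^ 4 := by gcongr
      _ = i * i := by linear_combination i ^ 2 * (i * w + 1) * hiw
      _ ≤ i := by nlinarith
  have t4 : z ^ 2 ≤ i := by
    calc z ^ 2 ≤ i ^ 2 := by gcongr
      _ ≤ i := by nlinarith
  have t5 : ρ ≤ i := by nlinarith
  have fin : 2 * z + 2 * n₀ * ρ + 2 * n₀ * (2 * z) + 4 * (z ^ 2 * (1 + w)) + 8 * (w ^ 2 * z ^ 3)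
      + 2 * n₀ * (3 * z ^ 2) + 5 * (w ^ 2 * z ^ 4) ≤ (4 + 14 * n₀ + 30) * i := by
    have u1 := mul_le_mul_of_nonneg_left t5 hN
    have u2 := mul_le_mul_of_nonneg_left z1 hN
    have u3 := mul_le_mul_of_nonneg_left t4 hN
    nlinarith
  have : (4 + 14 * (n₀ : ℝ) + 30) / w = (4 + 14 * n₀ + 30) * i := by rw [hi]; ring
  rw [this]
  refine le_trans (le_of_eq ?_) (mul_le_mul_of_nonneg_left fin hρ.le)
  rw [hz]; ring

end AndOr


namespace AndOr

open Filter Topology Finset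
open AT

variable {n : ℕ}

/-- complementary literal -/
def cpl (p : Fin n × Bool) : Fin n × Bool := (p.1, !p.2)

lemma cpl_inj : Function.Injective (cpl (n := n)) := by
  rintro ⟨a, b⟩ ⟨c, d⟩ h
  simp only [cpl, Prod.mk.injEq] at h
  obtain ⟨h1, h2⟩ := h
  subst h1
  simpa using h2

/-- leaf list -/
def lvs (J : ℕ) (v : Fin J → Fin n × Bool) : List (AT n) :=
  List.ofFn (fun i => AT.leaf (v i).1 (v i).2)

lemma lvs_len (J : ℕ) (v : Fin J → Fin n × Bool) : (lvs J v).length = J := by simp [lvs]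

lemma lvs_good (J : ℕ) (v : Fin J → Fin n × Bool) (c : Bool) : Good c (lvs J v) := by
  intro t ht
  simp only [lvs, List.mem_ofFn] at ht
  obtain ⟨i, rfl⟩ := ht
  exact good_leaf (v i)

lemma lvs_inj (J : ℕ) : Function.Injective (lvs (n := n) J) := by
  intro v w h
  have := List.ofFn_injective h
  funext i
  have h2 := congrFun this i
  simp only [AT.leaf.injEq] at h2
  exact Prod.ext h2.1 h2.2

lemma lvs_size (J : ℕ) : ∀ (v : Fin J → Fin n × Bool), sizeList (lvs J v) = J := by
  induction J with
  | zero => intro v; simp [lvs, sizeList_nil]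
  | succ J ih =>
    intro v
    have := ih (fun i => v i.succ)
    unfold lvs at this ⊢
    rw [List.ofFn_succ, sizeList_cons, size_leaf, this]; omega

/-- hitting words -/
noncomputable def HW (n J : ℕ) : Finset (Σ _ : (Fin J ↪ Fin n × Bool), (Fin J → Fin n × Bool)) :=
  univ.sigma (fun u => univ \ Fintype.piFinset (fun _ : Fin J => univ \ univ.image (fun i => cpl (u i))))

lemma card_HW (n J : ℕ) : (HW n J).card = (2 * n).descFactorial J * ((2 * n) ^ J - (2 * n - J) ^ J) := by
  unfold HW
  rw [card_sigma]
  have : ∀ u : (Fin J ↪ Fin n × Bool),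
      (univ \ Fintype.piFinset (fun _ : Fin J => univ \ univ.image (fun i => cpl (u i)))).card
       = (2 * n) ^ J - (2 * n - J) ^ J := by
    intro u
    rw [card_sdiff_of_subset (subset_univ _), Fintype.card_piFinset]
    have h1 : (univ \ univ.image (fun i => cpl (u i))).card = 2 * n - J := by
      rw [card_sdiff_of_subset (subset_univ _), card_image_of_injective]
      · simp [mul_comm]
      · exact cpl_inj.comp u.injective
    simp only [h1]
    simp [mul_comm]
  rw [sum_congr rfl (fun u _ => this u), sum_const, card_univ, Fintype.card_embedding_eq]
  simp [mul_comm]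

lemma HW_hit {J : ℕ} {z : Σ _ : (Fin J ↪ Fin n × Bool), (Fin J → Fin n × Bool)} (hz : z ∈ HW n J) :
    ∃ i j, z.2 j = cpl (z.1 i) := by
  unfold HW at hz
  rw [mem_sigma] at hz
  have h := hz.2
  rw [Finset.mem_sdiff] at h
  simp only [mem_univ, true_and, Fintype.mem_piFinset, mem_image, not_forall,
    not_not, Finset.mem_sdiff] at h
  obtain ⟨j, i, hi⟩ := h
  exact ⟨i, j, hi.symm⟩

lemma true_count (J m : ℕ) (hJ : 1 ≤ J) (hm : 2 * J ≤ m) :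
    ((HW n J).card : ℝ) * ll n (m - 2 * J) ≤ (countIn n {t | eval t = fun _ => true} (m + 1) : ℝ) := by
  classical
  rw [countIn_eq _ m (by omega), ← card_ll false]
  norm_cast
  refine le_trans ?_ (Nat.le_add_left _ _)
  rw [← card_product]
  apply card_le_card_of_injOn (fun z => lvs J z.1.1 ++ (lvs J z.1.2 ++ z.2))
  · rintro ⟨⟨u, v⟩, ts⟩ hz
    simp only [coe_product, Set.mem_prod, mem_coe] at hz
    obtain ⟨hz, hts⟩ := hz
    rw [mem_SF] at hts
    simp only [coe_filter, Set.mem_ofPred_eq]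
    refine ⟨?_, ?_⟩
    · rw [mem_SF]
      refine ⟨good_append.2 ⟨lvs_good _ _ _, good_append.2 ⟨lvs_good _ _ _, hts.1⟩⟩, ?_, ?_⟩
      · simp only [List.length_append, lvs_len]; omega
      · rw [sizeList_append, sizeList_append, lvs_size, lvs_size, hts.2.2]; omega
    · rw [eval_node]
      funext x
      rw [evalList_or]
      obtain ⟨i, j, hij⟩ := HW_hit hz
      by_cases hx : eval (AT.leaf (u i).1 (u i).2) x = true
      · refine ⟨_, ?_, hx⟩
        apply List.mem_append_left
        simp only [lvs, List.mem_ofFn]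
        exact ⟨i, rfl⟩
      · refine ⟨AT.leaf (v j).1 (v j).2, ?_, ?_⟩
        · apply List.mem_append_right
          apply List.mem_append_left
          simp only [lvs, List.mem_ofFn]
          exact ⟨j, rfl⟩
        · simp only at hij
          rw [hij]
          rw [eval] at hx ⊢
          simp only [cpl]
          generalize u i = p at hx ⊢
          obtain ⟨k, b⟩ := p
          cases b <;> simpa using hx
  · rintro ⟨⟨u, v⟩, ts⟩ _ ⟨⟨u', v'⟩, ts'⟩ _ h
    simp only at h
    obtain ⟨h1, h2⟩ := List.append_inj h (by rw [lvs_len, lvs_len])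
    obtain ⟨h3, h4⟩ := List.append_inj h2 (by rw [lvs_len, lvs_len])
    have e1 := DFunLike.coe_injective (lvs_inj J h1)
    have e2 := lvs_inj J h3
    subst e1 e2 h4
    rfl

/-- the numeric bound -/
lemma W_bound (hn : 1 ≤ n) :
    1 / 18 * Real.exp (-4) ≤ ((HW n (Nat.sqrt n)).card : ℝ) * rho (2 * n) ^ (2 * Nat.sqrt n) := by
  set J := Nat.sqrt n with hJ
  have hJ1 : 1 ≤ J := by rw [hJ, Nat.succ_le_iff, Nat.sqrt_pos]; omega
  have hJn : J * J ≤ n := Nat.sqrt_le n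
  have hJn2 : n < (J + 1) * (J + 1) := Nat.lt_succ_sqrt n
  have hJle : J ≤ n := by nlinarith
  have hn4 : n ≤ 4 * (J * J) := by nlinarith
  have hnR : (1 : ℝ) ≤ n := by exact_mod_cast hn
  have hJR : (1 : ℝ) ≤ J := by exact_mod_cast hJ1
  have hJnR : (J : ℝ) * J ≤ n := by exact_mod_cast hJn
  have hn4R : (n : ℝ) ≤ 4 * (J * J) := by exact_mod_cast hn4
  have hJleR : (J : ℝ) ≤ n := by exact_mod_cast hJle
  set N : ℝ := 2 * (n : ℝ) with hN
  have hN0 : 0 < N := by rw [hN]; linarith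
  set x : ℝ := J / N with hx
  have hx0 : 0 ≤ x := by rw [hx]; positivity
  have hx1 : x ≤ 1 / 2 := by rw [hx, div_le_iff₀ hN0]; rw [hN]; linarith
  set q : ℝ := (1 - x) ^ J with hq
  have hJx : (J : ℝ) * x = J * J / N := by rw [hx]; ring
  have hJx1 : (J : ℝ) * x ≤ 1 / 2 := by rw [hJx, div_le_iff₀ hN0]; rw [hN]; linarith
  have hJx2 : 1 / 8 ≤ (J : ℝ) * x := by rw [hJx, le_div_iff₀ hN0]; rw [hN]; linarith
  have hq1 : 1 / 2 ≤ q := by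
    have := one_add_mul_le_pow (a := -x) (by linarith) J
    rw [hq, sub_eq_add_neg]; linarith
  have hq2 : q ≤ 8 / 9 := by
    have h1 := one_add_mul_le_pow (a := x) (by linarith) J
    have h2 : q * (1 + x) ^ J ≤ 1 := by
      rw [hq, ← mul_pow]
      apply pow_le_one₀
      · nlinarith
      · nlinarith
    have h3 : (9 / 8 : ℝ) ≤ (1 + x) ^ J := by linarith
    nlinarith
  have hD : N ^ J * q ≤ ((2 * n).descFactorial J : ℝ) := by
    have h1 := Nat.pow_sub_le_descFactorial (2 * n) J
    have h2 : (2 * n - J) ^ J ≤ (2 * n).descFactorial J :=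
      le_trans (Nat.pow_le_pow_left (by omega) _) h1
    have h3 : (((2 * n - J) ^ J : ℕ) : ℝ) ≤ ((2 * n).descFactorial J : ℝ) := by exact_mod_cast h2
    refine le_trans (le_of_eq ?_) h3
    rw [hq, ← mul_pow]
    push_cast [Nat.cast_sub (show J ≤ 2 * n by omega)]
    congr 1
    rw [hx]; field_simp
    try rw [hN]
  have hE : (((2 * n) ^ J - (2 * n - J) ^ J : ℕ) : ℝ) = N ^ J * (1 - q) := by
    rw [Nat.cast_sub (Nat.pow_le_pow_left (by omega) _)]
    push_cast [Nat.cast_sub (show J ≤ 2 * n by omega)]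
    rw [mul_sub, mul_one, hq, ← mul_pow]
    congr 2
    rw [hx]; field_simp
    try rw [hN]
  have hw : 0 < √N := Real.sqrt_pos.2 hN0
  have hJw : (J : ℝ) ≤ √N := by
    apply Real.le_sqrt_of_sq_le; rw [hN]; nlinarith
  have hρ : Real.exp (-4) ≤ (N * rho N) ^ (2 * J) := by
    have h1 : N * rho N = (1 + 2 / √N)⁻¹ := by
      have hs : √N * √N = N := Real.mul_self_sqrt hN0.le
      unfold rho RR
      rw [← div_eq_mul_inv, ← inv_div]
      congr 1
      rw [add_div, div_self hN0.ne']
      congr 1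
      rw [div_eq_div_iff hN0.ne' hw.ne']
      linear_combination 2 * hs
    rw [h1, inv_pow, Real.exp_neg]
    apply inv_anti₀ (by positivity)
    calc (1 + 2 / √N) ^ (2 * J) ≤ (Real.exp (2 / √N)) ^ (2 * J) := by
          gcongr
          linarith [Real.add_one_le_exp (2 / √N)]
      _ = Real.exp ((2 * J : ℕ) * (2 / √N)) := by rw [← Real.exp_nat_mul]
      _ ≤ Real.exp 4 := by
          apply Real.exp_le_exp.2
          push_cast
          rw [mul_div_assoc', div_le_iff₀ hw]
          linarith
  rw [card_HW]
  push_cast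
  rw [hE]
  have hr : 0 < rho N := by
    unfold rho RR; positivity
  calc 1 / 18 * Real.exp (-4) ≤ (q * (1 - q)) * (N * rho N) ^ (2 * J) := by
        apply mul_le_mul _ hρ (Real.exp_pos _).le
        · nlinarith
        · nlinarith
    _ = (N ^ J * q) * (N ^ J * (1 - q)) * rho N ^ (2 * J) := by rw [mul_pow, two_mul, pow_add, pow_add]; ring
    _ ≤ _ := by
        gcongr
        nlinarith

lemma P_true_lb (hn : 1 ≤ n) {a : ℝ}
    (ha : Tendsto (fun m => Pmn n m (fun _ => true)) atTop (𝓝 a)) : 1 / 36 * Real.exp (-4) ≤ a := by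
  have h := mot hn
  set J := Nat.sqrt n with hJ
  have hJ1 : 1 ≤ J := by rw [hJ, Nat.succ_le_iff, Nat.sqrt_pos]; omega
  have h1 : Tendsto (fun m => (((HW n J).card : ℝ) / 2) * (ll n (m - 2 * J) / ll n m)) atTop
      (𝓝 (((HW n J).card : ℝ) / 2 * rho (2 * n) ^ (2 * J))) := (h.ratio_sub _).const_mul _
  have h2 := ha.comp (tendsto_add_atTop_nat 1)
  have h3 : ((HW n J).card : ℝ) / 2 * rho (2 * n) ^ (2 * J) ≤ a := by
    refine le_of_tendsto_of_tendsto h1 h2 ?_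
    filter_upwards [eventually_ge_atTop (2 * J + 2)] with m hm
    simp only [Function.comp, Pmn]
    rw [A_eq m (by omega)]
    have hb := bb_le_ll (n := n) m
    have hc := true_count (n := n) J m hJ1 (by omega)
    have hbp : 0 < bb n m := by
      obtain ⟨m, rfl⟩ : ∃ k, m = k + 1 := ⟨m - 1, by omega⟩
      rw [bb_succ]
      have hnR : (1 : ℝ) ≤ n := by exact_mod_cast hn
      have := h.pos' (m := m) (by omega)
      have hs : 0 ≤ ∑ p ∈ antidiagonal m, bb n p.1 * ll n p.2 :=
        sum_nonneg (fun p _ => mul_nonneg (bb_nonneg _) (ll_nonneg _))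
      nlinarith
    have e : ((HW n J).card : ℝ) / 2 * (ll n (m - 2 * J) / ll n m)
        = ((HW n J).card : ℝ) * ll n (m - 2 * J) / (2 * ll n m) := by
      rw [div_mul_div_comm]
    rw [e]
    exact div_le_div₀ (by positivity) hc (by positivity) (by linarith)
  have := W_bound hn
  rw [← hJ] at this
  linarith

end AndOr


namespace AndOr

open Filter Topology Finset
open AT

variable {n : ℕ}

lemma gap_count {n₀ : ℕ} (h : n₀ ≤ n) (f₀ : (Fin n₀ → Bool) → Bool) (y₀ : Fin n₀ → Bool)
    (hy : f₀ y₀ = true) (S : Finset (G n)) (hS : ∀ g ∈ S, (∀ x, extend h f₀ x ≤ g x) ∧ g ≠ fun _ => true)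
    {Q : PowerSeries ℝ} (hQ : Dom (Bad h y₀) size Q) (m : ℕ) (hm : 1 ≤ m) :
    ∑ g ∈ S, (countIn n {t | eval t = g} (m + 1) : ℝ) ≤ PowerSeries.coeff (m + 1) Q := by
  classical
  obtain ⟨F, hF, hc⟩ := hQ (m + 1)
  refine le_trans ?_ hc
  have h1 : ∀ g ∈ S, countIn n {t | eval t = g} (m + 1) ≤ (F.filter (fun t => eval t = g)).card := by
    intro g hg
    obtain ⟨hg1, hg2⟩ := hS g hg
    unfold countIn
    have key : ∀ t : {t : AT n // t ∈ {t | eval t = g} ∧ WF t ∧ size t = m + 1},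
        t.1 ∈ F.filter (fun t => eval t = g) := by
      rintro ⟨t, ht, hw, hs⟩
      rw [Set.mem_ofPred_eq] at ht
      rw [mem_filter]
      refine ⟨hF t ⟨?_, ?_, hw, ?_⟩ hs, ht⟩
      · intro x hx
        rw [ht]
        have := hg1 x
        have e : extend h f₀ x = true := by
          unfold extend
          rw [← hy]
          congr 1
          funext j
          exact hx j
        rw [e] at this
        exact top_le_iff.1 this
      · rw [ht]; exact hg2
      · cases t with
        | leaf i b => rw [size_leaf] at hs; omega
        | node c ts => exact ⟨c, ts, rfl⟩
    have := Nat.card_le_card_of_injective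
      (fun t : {t : AT n // t ∈ {t | eval t = g} ∧ WF t ∧ size t = m + 1} =>
        (⟨t.1, key t⟩ : {t // t ∈ F.filter (fun t => eval t = g)}))
      (by
        intro a b hab
        simp only [Subtype.mk.injEq] at hab
        exact Subtype.ext hab)
    refine this.trans (le_of_eq ?_)
    rw [Nat.card_eq_fintype_card, Fintype.card_coe]
  have h2 : ∑ g ∈ S, countIn n {t | eval t = g} (m + 1) ≤ F.card := by
    refine (sum_le_sum h1).trans ?_
    rw [← card_biUnion]
    · apply card_le_card
      intro t ht
      rw [mem_biUnion] at ht
      obtain ⟨g, _, hg⟩ := ht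
      exact (mem_filter.1 hg).1
    · intro a _ b _ hab
      rw [Function.onFun, disjoint_left]
      intro t h1 h2
      exact hab ((mem_filter.1 h1).2.symm.trans (mem_filter.1 h2).2)
  exact_mod_cast h2

lemma gap {n₀ : ℕ} (h : n₀ ≤ n) (hn : 1 ≤ n) (f₀ : (Fin n₀ → Bool) → Bool) (y₀ : Fin n₀ → Bool)
    (hy : f₀ y₀ = true) (S : Finset (G n)) (hS : ∀ g ∈ S, (∀ x, extend h f₀ x ≤ g x) ∧ g ≠ fun _ => true)
    (P : G n → ℝ) (hP : ∀ g, Tendsto (fun m => Pmn n m g) atTop (𝓝 (P g))) :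
    ∑ g ∈ S, P g ≤ kap n₀ n := by
  obtain ⟨Q, a, s, hQ, hA, ha⟩ := bad_dom h y₀ hn
  have hm := mot hn
  have hR := RR_pos hm.hβ
  have hρ := rho_pos hm.hβ
  have hlim : Tendsto (fun m => ∑ g ∈ S, Pmn n (m + 1) g) atTop (𝓝 (∑ g ∈ S, P g)) :=
    tendsto_finsetSum _ (fun g _ => (hP g).comp (tendsto_add_atTop_nat 1))
  have hB := (asyB hn).lim
  have hU : Tendsto (fun m => (PowerSeries.coeff (m + 1) Q / ll n (m + 1)) * (ll n (m + 1) / ll n m)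
      / (2 * (PowerSeries.coeff m (PowerSeries.mk (bb n)) / ll n m))) atTop
      (𝓝 (a * RR (2 * n) / (2 * (1 + rho (2 * n))⁻¹))) :=
    ((hA.lim.comp (tendsto_add_atTop_nat 1)).mul hm.ratio).div (hB.const_mul 2) (by positivity)
  have hle : ∑ g ∈ S, P g ≤ a * RR (2 * n) / (2 * (1 + rho (2 * n))⁻¹) := by
    refine le_of_tendsto_of_tendsto hlim hU ?_
    filter_upwards [eventually_ge_atTop 2] with m hm2
    have hl1 := hm.pos' (m := m) (by omega)
    have hl2 := hm.pos' (m := m + 1) (by omega)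
    have hc := gap_count h f₀ y₀ hy S hS hQ m (by omega)
    simp only [Pmn]
    rw [← sum_div, A_eq m (by omega), PowerSeries.coeff_mk]
    have e : PowerSeries.coeff (m + 1) Q / ll n (m + 1) * (ll n (m + 1) / ll n m) / (2 * (bb n m / ll n m))
        = PowerSeries.coeff (m + 1) Q / (2 * bb n m) := by
      rw [div_mul_div_cancel₀ hl2.ne', ← mul_div_assoc, div_div_div_cancel_right₀ hl1.ne']
    rw [e]
    exact div_le_div_of_nonneg_right hc (mul_nonneg (by norm_num) (bb_nonneg _))
  refine hle.trans ?_
  have hk : 0 ≤ kap n₀ n := by unfold kap; positivity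
  have hρR : rho (2 * n) * RR (2 * (n : ℝ)) = 1 := inv_mul_cancel₀ hR.ne'
  have hρ1 : rho (2 * (n : ℝ)) ≤ 1 := by
    unfold rho
    apply inv_le_one_of_one_le₀
    have := hm.hβ
    have := Real.sqrt_nonneg (2 * (n : ℝ))
    unfold RR; linarith
  have h1 : a * RR (2 * n) ≤ kap n₀ n := by
    calc a * RR (2 * n) ≤ (rho (2 * n) * kap n₀ n) * RR (2 * n) := by gcongr
      _ = (rho (2 * n) * RR (2 * n)) * kap n₀ n := by ring
      _ = kap n₀ n := by rw [hρR, one_mul]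
  have h2 : 1 ≤ 2 * (1 + rho (2 * (n : ℝ)))⁻¹ := by
    rw [← div_eq_mul_inv, le_div_iff₀ (by positivity)]; linarith
  rw [div_le_iff₀ (by positivity)]
  nlinarith

lemma kap_tendsto (n₀ : ℕ) : Tendsto (fun n => kap n₀ n) atTop (𝓝 0) := by
  unfold kap
  apply Tendsto.div_atTop tendsto_const_nhds
  apply Real.tendsto_sqrt_atTop.comp
  exact tendsto_natCast_atTop_atTop.const_mul_atTop (by norm_num)

theorem main (n₀ : ℕ) (hn₀ : 1 ≤ n₀) (f₀ : (Fin n₀ → Bool) → Bool)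
    (hf₀' : f₀ ≠ fun _ => false) :
    ∃ P : (n : ℕ) → ((Fin n → Bool) → Bool) → ℝ,
      (∀ (n : ℕ) (f : (Fin n → Bool) → Bool),
        Tendsto (fun m => Pmn n m f) atTop (nhds (P n f))) ∧
      ∃ ε : ℕ → ℝ, Tendsto ε atTop (nhds 0) ∧
        ∀ n : ℕ, ∀ h : n₀ ≤ n,
          (∑ g ∈ Finset.univ.filter
              (fun g : (Fin n → Bool) → Bool => ∀ x, extend h f₀ x ≤ g x), P n g)
            = P n (fun _ => true) * (1 + ε n) := by
  classical
  obtain ⟨y₀, hy⟩ : ∃ y, f₀ y = true := by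
    by_contra hcon
    push Not at hcon
    apply hf₀'
    funext y
    simpa using hcon y
  choose P hP using P_exists
  have hP0 : ∀ n g, 0 ≤ P n g := fun n g => ge_of_tendsto' (hP n g) (fun m => by unfold Pmn; positivity)
  refine ⟨P, hP, fun n => if h : n₀ ≤ n then
    (∑ g ∈ (Finset.univ.filter (fun g : (Fin n → Bool) → Bool => ∀ x, extend h f₀ x ≤ g x)).erase
      (fun _ => true), P n g) / P n (fun _ => true) else 0, ?_, ?_⟩
  · set c : ℝ := 1 / 36 * Real.exp (-4) with hc
    have hc0 : 0 < c := by positivity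
    have hk : Tendsto (fun n => kap n₀ n / c) atTop (𝓝 0) := by
      simpa using (kap_tendsto n₀).div_const c
    refine tendsto_of_tendsto_of_tendsto_of_le_of_le tendsto_const_nhds hk ?_ ?_
    · intro n
      dsimp only
      split_ifs with h
      · exact div_nonneg (sum_nonneg (fun g _ => hP0 n g)) (hP0 n _)
      · exact le_rfl
    · intro n
      dsimp only
      split_ifs with h
      · have hn : 1 ≤ n := by omega
        apply div_le_div₀ (by unfold kap; positivity) _ hc0 (P_true_lb hn (hP n _))
        apply gap h hn f₀ y₀ hy _ _ (P n) (hP n)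
        intro g hg
        rw [mem_erase, mem_filter] at hg
        exact ⟨hg.2.2, hg.1⟩
      · unfold kap; positivity
  · intro n h
    have hn : 1 ≤ n := by omega
    have hpos : 0 < P n (fun _ => true) := lt_of_lt_of_le (by positivity) (P_true_lb hn (hP n _))
    simp only [h, dite_true]
    rw [mul_add, mul_one, mul_div_cancel₀ _ hpos.ne']
    rw [add_sum_erase]
    rw [mem_filter]
    exact ⟨mem_univ _, fun x => le_top⟩

end AndOr

open Filter in
/-- For a fixed non-constant Boolean function `f₀` of `n₀` variables, identified
with its extension to `n ≥ n₀` variables,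
`Σ_{g ≥ f₀} P_n(g) = P_n(True)·(1 + o(1))` as `n → ∞`, the sum being over all
Boolean functions `g` of `n` variables with `g ≥ f₀` pointwise. -/
theorem statement15 (n₀ : ℕ) (hn₀ : 1 ≤ n₀) (f₀ : (Fin n₀ → Bool) → Bool)
    (hf₀ : f₀ ≠ fun _ => true) (hf₀' : f₀ ≠ fun _ => false) :
    ∃ P : (n : ℕ) → ((Fin n → Bool) → Bool) → ℝ,
      (∀ (n : ℕ) (f : (Fin n → Bool) → Bool),
        Tendsto (fun m => Pmn n m f) atTop (nhds (P n f))) ∧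
      ∃ ε : ℕ → ℝ, Tendsto ε atTop (nhds 0) ∧
        ∀ n : ℕ, ∀ h : n₀ ≤ n,
          (∑ g ∈ Finset.univ.filter
              (fun g : (Fin n → Bool) → Bool => ∀ x, extend h f₀ x ≤ g x), P n g)
            = P n (fun _ => true) * (1 + ε n) := by
  exact AndOr.main n₀ hn₀ f₀ hf₀'
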